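/- arXiv:1506.02835 — 2 statements merged into one kernel-verified Lean document; each statement's English description precedes it below -/
import Mathlib

section
/- Let β > 0 and let f be a solution of the equation f''' + f·f'' + β·f'·(f'−1) = 0 on an interval I such that f' is not constant on I. (1) If there exist s < r in I with f''(t) < 0 for all t ∈ (s,r) and f''(r) = 0, then f'(r)·(f'(r)−1) < 0, i.e. 0 < f'(r) < 1. (2) If there exist s < r in I with f''(t) > 0 for all t ∈ (s,r) and f''(r) = 0, then f'(r)·(f'(r)−1) > 0. -/
open Set Filter Topology

lemma aux_uniq (u h f q : ℝ → ℝ) (β s r : ℝ) (hsr : s < r)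
    (hu : ∀ t, HasDerivAt u (h t) t) (h' : ℝ → ℝ) (hh : ∀ t, HasDerivAt h (h' t) t)
    (hf : Continuous f) (hq : Continuous q)
    (e : ∀ t ∈ Icc s r, h' t = - f t * h t - β * q t * u t)
    (hur : u r = 0) (hhr : h r = 0) : ∀ t ∈ Icc s r, h t = 0 := by
  have hc : Continuous (fun t => |1 - β * q t| + 2 * |f t|) := by fun_prop
  obtain ⟨K, hK⟩ := (isCompact_Icc (a := s) (b := r)).bddAbove_image hc.continuousOn
  have hK' : ∀ t ∈ Icc s r, |1 - β * q t| + 2 * |f t| ≤ K := fun t ht => hK ⟨t, ht, rfl⟩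
  have hd : ∀ t, HasDerivAt (fun t => (u t * u t + h t * h t) * Real.exp (K * t))
      ((h t * u t + u t * h t + (h' t * h t + h t * h' t)) * Real.exp (K * t)
        + (u t * u t + h t * h t) * (Real.exp (K * t) * (K * 1))) t := fun t =>
    (((hu t).mul (hu t)).add ((hh t).mul (hh t))).mul (((hasDerivAt_id t).const_mul K).exp)
  have hm : MonotoneOn (fun t => (u t * u t + h t * h t) * Real.exp (K * t)) (Icc s r) := by
    apply monotoneOn_of_deriv_nonneg (convex_Icc s r)
    · exact fun t _ => (hd t).continuousAt.continuousWithinAt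
    · exact fun t _ => (hd t).differentiableAt.differentiableWithinAt
    · intro t ht
      have ht' := interior_subset ht
      rw [(hd t).deriv, e t ht']
      have hk := hK' t ht'
      have h1 : 0 ≤ 2 * (1 - β * q t) * (u t * h t) - 2 * f t * h t ^ 2
          + K * (u t ^ 2 + h t ^ 2) := by
        have a1 : -(|1 - β * q t| * (u t ^ 2 + h t ^ 2)) ≤ 2 * (1 - β * q t) * (u t * h t) := by
          rcases abs_cases (1 - β * q t) with ⟨x, y⟩ | ⟨x, y⟩ <;> rw [x]
          · nlinarith [mul_nonneg y (sq_nonneg (u t + h t))]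
          · nlinarith [mul_nonneg (neg_nonneg.2 y.le) (sq_nonneg (u t - h t))]
        have a2 : f t * h t ^ 2 ≤ |f t| * (u t ^ 2 + h t ^ 2) := by
          nlinarith [mul_le_mul_of_nonneg_right (le_abs_self (f t)) (sq_nonneg (h t)),
            mul_nonneg (abs_nonneg (f t)) (sq_nonneg (u t))]
        nlinarith [mul_le_mul_of_nonneg_right hk (add_nonneg (sq_nonneg (u t)) (sq_nonneg (h t)))]
      have := mul_nonneg h1 (Real.exp_pos (K * t)).le
      linarith
  intro t ht
  have := hm ht (right_mem_Icc.2 hsr.le) ht.2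
  simp only [hur, hhr, mul_zero, add_zero, zero_mul] at this
  have h2 := Real.exp_pos (K * t)
  have h3 : u t * u t + h t * h t ≤ 0 := by
    by_contra hcon
    push Not at hcon
    have := mul_pos hcon h2
    linarith
  have : h t * h t = 0 := by nlinarith [mul_self_nonneg (u t), mul_self_nonneg (h t)]
  exact mul_self_eq_zero.1 this

lemma aux_sign (h : ℝ → ℝ) (d s r : ℝ) (hsr : s < r) (hh : HasDerivAt h d r)
    (hn : ∀ t ∈ Ioo s r, h t < 0) (h0 : h r = 0) : 0 ≤ d := by
  have h1 := (hasDerivWithinAt_iff_tendsto_slope' (s := Iio r) (by simp)).1 hh.hasDerivWithinAt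
  refine ge_of_tendsto h1 ?_
  filter_upwards [Ioo_mem_nhdsLT hsr] with t ht
  rw [slope_def_field, h0]
  exact div_nonneg_of_nonpos (by linarith [hn t ht]) (by linarith [ht.2])

/-- value of `f'` at a point where `f''` vanishes after keeping a
constant sign, for solutions of `f''' + f f'' + β f'(f'-1) = 0` with `β > 0`
and `f'` not constant. -/
theorem stmt2 (β : ℝ) (hβ : 0 < β) (f : ℝ → ℝ) (I : Set ℝ) (hI : I.OrdConnected)
    (hf : ContDiff ℝ 3 f)
    (heq : ∀ t ∈ I, deriv (deriv (deriv f)) t + f t * deriv (deriv f) t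
      + β * deriv f t * (deriv f t - 1) = 0)
    (hnc : ¬ ∀ x ∈ I, ∀ y ∈ I, deriv f x = deriv f y) :
    (∀ s ∈ I, ∀ r ∈ I, s < r →
      (∀ t ∈ Ioo s r, deriv (deriv f) t < 0) → deriv (deriv f) r = 0 →
      deriv f r * (deriv f r - 1) < 0 ∧ 0 < deriv f r ∧ deriv f r < 1) ∧
    (∀ s ∈ I, ∀ r ∈ I, s < r →
      (∀ t ∈ Ioo s r, 0 < deriv (deriv f) t) → deriv (deriv f) r = 0 →
      0 < deriv f r * (deriv f r - 1)) := by
  have c1 : ContDiff ℝ 2 (deriv f) := ((contDiff_succ_iff_deriv (n := 2)).1 hf).2.2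
  have c2 : ContDiff ℝ 1 (deriv (deriv f)) := ((contDiff_succ_iff_deriv (n := 1)).1 c1).2.2
  have d1 : ∀ t, HasDerivAt (deriv f) (deriv (deriv f) t) t := fun t =>
    (c1.differentiable (by norm_num) t).hasDerivAt
  have d2 : ∀ t, HasDerivAt (deriv (deriv f)) (deriv (deriv (deriv f)) t) t := fun t =>
    (c2.differentiable (by norm_num) t).hasDerivAt
  have key : ∀ s ∈ I, ∀ r ∈ I, s < r → (∀ t ∈ Ioo s r, deriv (deriv f) t ≠ 0) →
      deriv (deriv f) r = 0 → deriv f r * (deriv f r - 1) ≠ 0 := by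
    intro s hs r hr hsr hne h0 hz
    have hm : (s + r) / 2 ∈ Ioo s r := ⟨by linarith, by linarith⟩
    apply hne _ hm
    rcases mul_eq_zero.1 hz with hz | hz
    · refine aux_uniq (deriv f) (deriv (deriv f)) f (fun t => deriv f t - 1) β s r hsr d1 _ d2
        hf.continuous (c1.continuous.sub continuous_const) ?_ hz h0 _ (Ioo_subset_Icc_self hm)
      intro t ht
      linarith [heq t (hI.out hs hr ht)]
    · refine aux_uniq (fun t => deriv f t - 1) (deriv (deriv f)) f (deriv f) β s r hsr
        (fun t => (d1 t).sub_const 1) _ d2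
        hf.continuous c1.continuous ?_ hz h0 _ (Ioo_subset_Icc_self hm)
      intro t ht
      linarith [heq t (hI.out hs hr ht)]
  constructor
  · intro s hs r hr hsr hn h0
    have k := key s hs r hr hsr (fun t ht => (hn t ht).ne) h0
    have hd := aux_sign _ _ s r hsr (d2 r) hn h0
    have e := heq r hr
    rw [h0] at e
    have h1 : deriv f r * (deriv f r - 1) < 0 := by
      refine lt_of_le_of_ne ?_ k
      by_contra hc
      push Not at hc
      nlinarith [mul_pos hβ hc]
    exact ⟨h1, by nlinarith, by nlinarith⟩
  · intro s hs r hr hsr hn h0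
    have k := key s hs r hr hsr (fun t ht => (hn t ht).ne') h0
    have hd := aux_sign (fun t => - deriv (deriv f) t) _ s r hsr (d2 r).neg
      (fun t ht => by linarith [hn t ht]) (by simp [h0])
    have e := heq r hr
    rw [h0] at e
    refine lt_of_le_of_ne ?_ k.symm
    by_contra hc
    push Not at hc
    nlinarith [mul_neg_of_pos_of_neg hβ hc]
end

section
/- Let β ∈ (0,1], a ≥ 0 and b ≥ 1. Then there exist real numbers c₊ < 0 and c* ∈ (c₊, −a(b−1)] such that, denoting by 'a solution with parameter c' a three times continuously differentiable f : [0,∞) → ℝ satisfying f''' + f·f'' + β·f'·(f'−1) = 0 on [0,∞) with f(0) = a, f'(0) = b, f''(0) = c: (i) for every c < c₊ there is no solution with parameter c on all of [0,∞); (ii) there is a solution with parameter c₊ that satisfies f'' < 0 on [0,∞) and f'(t) → 0 as t → +∞; (iii) for every c ∈ (c₊, c*) there is a solution with parameter c and a point t₀ > 0 with f'' < 0 on (0, t₀), f'' > 0 on (t₀, ∞), and f'(t) → 1 as t → +∞; (iv) for every c ∈ [c*, 0] there is a solution with parameter c satisfying f'' ≤ 0 and 1 ≤ f' ≤ b on [0,∞)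 and f'(t) → 1 as t → +∞; (v) for every c > 0 there is a solution with parameter c and a point t₀ > 0 with f'' > 0 on [0, t₀), f'' < 0 on (t₀, ∞), and f'(t) → 1 as t → +∞. -/
open Set Filter Topology

/-- `f` is a solution of `f''' + f f'' + β f'(f'-1) = 0` on `[0,∞)` with the
initial data `f(0) = a`, `f'(0) = b`, `f''(0) = c` (shooting parameter `c`). -/
def IsSolWithParam (β a b c : ℝ) (f : ℝ → ℝ) : Prop :=
  ContDiff ℝ 3 f ∧
  (∀ t ∈ Set.Ici (0 : ℝ), deriv (deriv (deriv f)) t + f t * deriv (deriv f) t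
    + β * deriv f t * (deriv f t - 1) = 0) ∧
  f 0 = a ∧ deriv f 0 = b ∧ deriv (deriv f) 0 = c


structure FS (β a b c T : ℝ) (f g h : ℝ → ℝ) : Prop where
  df : ∀ t ∈ Icc 0 T, HasDerivAt f (g t) t
  dg : ∀ t ∈ Icc 0 T, HasDerivAt g (h t) t
  dh : ∀ t ∈ Icc 0 T, HasDerivAt h (-(f t * h t) - β * g t * (g t - 1)) t
  f0 : f 0 = a
  g0 : g 0 = b
  h0 : h 0 = c

noncomputable def vf (β : ℝ) (x : ℝ × ℝ × ℝ) : ℝ × ℝ × ℝ :=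
  (x.2.1, x.2.2, -(x.1 * x.2.2) - β * x.2.1 * (x.2.1 - 1))

lemma vf_contDiff (β : ℝ) : ContDiff ℝ 1 (vf β) := by
  unfold vf; fun_prop

lemma vf_trunc (β : ℝ) (M : ℝ) (hM : 0 < M) :
    ∃ (W : ℝ × ℝ × ℝ → ℝ × ℝ × ℝ) (K L : NNReal), LipschitzWith K W ∧ (∀ x, ‖W x‖ ≤ L) ∧
      ∀ x ∈ Metric.closedBall (0 : ℝ × ℝ × ℝ) M, W x = vf β x := by
  let χ : ContDiffBump (0 : ℝ × ℝ × ℝ) := ⟨M, M + 1, hM, by linarith⟩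
  have hs : HasCompactSupport (fun x => χ x • vf β x) := χ.hasCompactSupport.smul_right
  have hc : ContDiff ℝ 1 (fun x => χ x • vf β x) := χ.contDiff.smul (vf_contDiff β)
  obtain ⟨K, hK⟩ := hc.lipschitzWith_of_hasCompactSupport hs (by simp)
  obtain ⟨L, hL⟩ := hs.exists_bound_of_continuous hc.continuous
  refine ⟨_, K, L.toNNReal, hK, fun x => (hL x).trans (Real.le_coe_toNNReal L), fun x hx => ?_⟩
  have : χ x = 1 := χ.one_of_mem_closedBall hx
  simp [this]

lemma ode_exist (W : ℝ × ℝ × ℝ → ℝ × ℝ × ℝ) (K L : NNReal) (hW : LipschitzWith K W)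
    (hL : ∀ x, ‖W x‖ ≤ L) (T : ℝ) (hT : 0 ≤ T) (x0 : ℝ × ℝ × ℝ) :
    ∃ α : ℝ → ℝ × ℝ × ℝ, α 0 = x0 ∧ ∀ t ∈ Icc 0 T, HasDerivAt α (W (α t)) t := by
  have hm : (0:ℝ) ∈ Icc (-(T+1)) (T+1) := ⟨by linarith, by linarith⟩
  have hp : IsPicardLindelof (fun _ => W) (tmin := -(T+1)) (tmax := T+1) ⟨0, hm⟩ x0
      (L * ⟨T+1, by linarith⟩) 0 L K := by
    apply IsPicardLindelof.of_time_independent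
    · intro x _; exact hL x
    · exact hW.lipschitzOnWith
    · simp
      exact le_rfl
  obtain ⟨α, h0, h1⟩ := hp.exists_eq_forall_mem_Icc_hasDerivWithinAt₀
  refine ⟨α, h0, fun t ht => ?_⟩
  exact (h1 t ⟨by linarith [ht.1], by linarith [ht.2]⟩).hasDerivAt
    (Icc_mem_nhds (by linarith [ht.1]) (by linarith [ht.2]))

lemma FS.vec {β a b c T : ℝ} {f g h : ℝ → ℝ} (H : FS β a b c T f g h) :
    ∀ t ∈ Icc 0 T, HasDerivAt (fun t => (f t, g t, h t)) (vf β (f t, g t, h t)) t := by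
  intro t ht
  exact (H.df t ht).prodMk ((H.dg t ht).prodMk (H.dh t ht))

lemma FS.of_vec {β a b c T : ℝ} {α : ℝ → ℝ × ℝ × ℝ} (h0 : α 0 = (a, b, c))
    (H : ∀ t ∈ Icc 0 T, HasDerivAt α (vf β (α t)) t) :
    FS β a b c T (fun t => (α t).1) (fun t => (α t).2.1) (fun t => (α t).2.2) := by
  constructor
  · intro t ht; exact (H t ht).fst
  · intro t ht; exact (H t ht).snd.fst
  · intro t ht; exact (H t ht).snd.snd
  all_goals simp [h0]

lemma FS.mono {β a b c T T' : ℝ} {f g h : ℝ → ℝ} (H : FS β a b c T f g h) (hT : T' ≤ T) :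
    FS β a b c T' f g h := by
  have : ∀ t ∈ Icc 0 T', t ∈ Icc 0 T := fun t ht => ⟨ht.1, ht.2.trans hT⟩
  exact ⟨fun t ht => H.df t (this t ht), fun t ht => H.dg t (this t ht),
    fun t ht => H.dh t (this t ht), H.f0, H.g0, H.h0⟩

lemma bdd_of_vec {T : ℝ} {α : ℝ → ℝ × ℝ × ℝ} (hα : ContinuousOn α (Icc 0 T)) :
    ∃ M > 0, ∀ t ∈ Icc 0 T, α t ∈ Metric.closedBall (0 : ℝ × ℝ × ℝ) M := by
  obtain ⟨M, hM⟩ := isCompact_Icc.exists_bound_of_continuousOn hα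
  refine ⟨max M 1, by simp, fun t ht => ?_⟩
  simpa using Or.inl (hM t ht)

lemma vec_unique {β T t₀ : ℝ} {x y : ℝ → ℝ × ℝ × ℝ} (ht₀ : t₀ ∈ Icc 0 T)
    (hx : ∀ t ∈ Icc 0 T, HasDerivAt x (vf β (x t)) t)
    (hy : ∀ t ∈ Icc 0 T, HasDerivAt y (vf β (y t)) t) (he : x t₀ = y t₀) :
    ∀ t ∈ Icc 0 T, x t = y t := by
  have cx : ContinuousOn x (Icc 0 T) := fun t ht => (hx t ht).continuousAt.continuousWithinAt
  have cy : ContinuousOn y (Icc 0 T) := fun t ht => (hy t ht).continuousAt.continuousWithinAt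
  obtain ⟨M, hM, hM1⟩ := bdd_of_vec cx
  obtain ⟨M', hM', hM1'⟩ := bdd_of_vec cy
  obtain ⟨W, K, L, hK, -, hW⟩ := vf_trunc β (max M M') (by positivity)
  have ex : ∀ t ∈ Icc 0 T, HasDerivAt x (W (x t)) t := by
    intro t ht
    rw [hW _ (Metric.closedBall_subset_closedBall (le_max_left _ _) (hM1 t ht))]
    exact hx t ht
  have ey : ∀ t ∈ Icc 0 T, HasDerivAt y (W (y t)) t := by
    intro t ht
    rw [hW _ (Metric.closedBall_subset_closedBall (le_max_right _ _) (hM1' t ht))]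
    exact hy t ht
  intro t ht
  rcases le_total t₀ t with h | h
  · have sub : Icc t₀ t ⊆ Icc 0 T := Icc_subset_Icc ht₀.1 ht.2
    exact ODE_solution_unique_of_mem_Icc_right (v := fun _ => W) (s := fun _ => univ)
      (fun _ _ => hK.lipschitzOnWith) (cx.mono sub)
      (fun s hs => (ex s (sub (Ico_subset_Icc_self hs))).hasDerivWithinAt) (fun _ _ => trivial)
      (cy.mono sub) (fun s hs => (ey s (sub (Ico_subset_Icc_self hs))).hasDerivWithinAt)
      (fun _ _ => trivial) he ⟨h, le_rfl⟩
  · have sub : Icc t t₀ ⊆ Icc 0 T := Icc_subset_Icc ht.1 ht₀.2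
    exact ODE_solution_unique_of_mem_Icc_left (v := fun _ => W) (s := fun _ => univ)
      (fun _ _ => hK.lipschitzOnWith) (cx.mono sub)
      (fun s hs => (ex s (sub (Ioc_subset_Icc_self hs))).hasDerivWithinAt) (fun _ _ => trivial)
      (cy.mono sub) (fun s hs => (ey s (sub (Ioc_subset_Icc_self hs))).hasDerivWithinAt)
      (fun _ _ => trivial) he ⟨le_rfl, h⟩

lemma FS.unique {β a b c T : ℝ} {f g h f' g' h' : ℝ → ℝ} (H : FS β a b c T f g h)
    (H' : FS β a b c T f' g' h') :
    ∀ t ∈ Icc 0 T, f t = f' t ∧ g t = g' t ∧ h t = h' t := by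
  intro t ht
  have := vec_unique (t₀ := 0) ⟨le_rfl, ht.1.trans ht.2⟩ H.vec H'.vec
    (by simp [H.f0, H.g0, H.h0, H'.f0, H'.g0, H'.h0]) t ht
  simpa using this

lemma FS.equil {β a b c T t : ℝ} {f g h : ℝ → ℝ} (H : FS β a b c T f g h) (ht : t ∈ Icc 0 T)
    (hg : g t = 0) (hh : h t = 0) : b = 0 := by
  have := vec_unique (y := fun _ => (f t, 0, 0)) ht H.vec
    (by intro s _; simpa [vf] using! hasDerivAt_const s _) (by simp [hg, hh]) 0
    ⟨le_rfl, ht.1.trans ht.2⟩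
  simp [H.g0] at this
  exact this.2.1

lemma FS.cd {β a b c T : ℝ} {f g h : ℝ → ℝ} (H : FS β a b c T f g h) (hT : 0 ≤ T) (ε : ℝ)
    (hε : 0 < ε) : ∃ δ > 0, ∀ c', |c' - c| < δ → ∃ f' g' h', FS β a b c' T f' g' h' ∧
      ∀ t ∈ Icc 0 T, |f' t - f t| < ε ∧ |g' t - g t| < ε ∧ |h' t - h t| < ε := by
  have cx : ContinuousOn (fun t => (f t, g t, h t)) (Icc 0 T) :=
    fun t ht => (H.vec t ht).continuousAt.continuousWithinAt
  obtain ⟨M, hM, hM1⟩ := bdd_of_vec cx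
  obtain ⟨W, K, L, hK, hL, hW⟩ := vf_trunc β (M + ε) (by positivity)
  have ex : ∀ t ∈ Icc 0 T, HasDerivAt (fun t => (f t, g t, h t)) (W (f t, g t, h t)) t := by
    intro t ht
    rw [hW _ (Metric.closedBall_subset_closedBall (by linarith) (hM1 t ht))]
    exact H.vec t ht
  refine ⟨ε / Real.exp (K * T), by positivity, fun c' hc' => ?_⟩
  obtain ⟨y, y0, hy⟩ := ode_exist W K L hK hL T hT (a, b, c')
  have cy : ContinuousOn y (Icc 0 T) := fun t ht => (hy t ht).continuousAt.continuousWithinAt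
  have key : ∀ t ∈ Icc 0 T, dist (y t) (f t, g t, h t) < ε := by
    intro t ht
    have := dist_le_of_trajectories_ODE (v := fun _ => W) (fun _ => hK) cy
      (fun s hs => (hy s (Ico_subset_Icc_self hs)).hasDerivWithinAt) cx
      (fun s hs => (ex s (Ico_subset_Icc_self hs)).hasDerivWithinAt) (δ := |c' - c|)
      (by simp [y0, H.f0, H.g0, H.h0, Prod.dist_eq, Real.dist_eq]) t ht
    refine this.trans_lt ?_
    rw [lt_div_iff₀ (by positivity)] at hc'
    refine lt_of_le_of_lt ?_ hc'
    have := ht.2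
    gcongr
    linarith
  have hy' : ∀ t ∈ Icc 0 T, HasDerivAt y (vf β (y t)) t := by
    intro t ht
    rw [← hW]
    · exact hy t ht
    · have h1 := key t ht
      have h2 := hM1 t ht
      simp only [Metric.mem_closedBall] at h2 ⊢
      linarith [dist_triangle (y t) (f t, g t, h t) 0]
  refine ⟨_, _, _, FS.of_vec y0 hy', fun t ht => ?_⟩
  have := key t ht
  simp only [Prod.dist_eq, Real.dist_eq, max_lt_iff] at this
  exact this

lemma FS.global_fin {β a b c : ℝ} (T M : ℝ) (hT : 0 ≤ T)
    (hM : ∀ T' ∈ Icc 0 T, ∀ f g h, FS β a b c T' f g h → |f T'| ≤ M ∧ |g T'| ≤ M ∧ |h T'| ≤ M) :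
    ∃ f g h, FS β a b c T f g h := by
  have hM0 : 0 ≤ M := by
    have H0 : FS β a b c 0 (fun t => a + t * b) (fun t => b + t * c)
        (fun t => c + t * (-(a * c) - β * b * (b - 1))) := by
      have e : ∀ x y t : ℝ, HasDerivAt (fun t => x + t * y) y t := fun x y t => by
        simpa using! ((hasDerivAt_id t).mul_const y).const_add x
      constructor
      · intro t ht; have : t = 0 := le_antisymm ht.2 ht.1
        subst this; simpa using! e a b 0
      · intro t ht; have : t = 0 := le_antisymm ht.2 ht.1
        subst this; simpa using! e b c 0
      · intro t ht; have : t = 0 := le_antisymm ht.2 ht.1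
        subst this; simpa using! e c _ 0
      all_goals simp
    exact (abs_nonneg _).trans (hM 0 ⟨le_rfl, hT⟩ _ _ _ H0).1
  set M' := max M ‖(a, b, c)‖ + 1 with hM'
  have hM'0 : 0 < M' := by positivity
  obtain ⟨W, K, L, hK, hL, hW⟩ := vf_trunc β M' hM'0
  obtain ⟨y, y0, hy⟩ := ode_exist W K L hK hL T hT (a, b, c)
  have cy : ContinuousOn y (Icc 0 T) := fun t ht => (hy t ht).continuousAt.continuousWithinAt
  have key : ∀ t ∈ Icc 0 T, ‖y t‖ ≤ M' := by
    by_contra! hcon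
    obtain ⟨t1, ht1, hlt⟩ := hcon
    -- first time when norm hits M'
    let A := Icc 0 T ∩ {t | M' ≤ ‖y t‖}
    have hAc : IsClosed A := by
      have := (cy.norm).preimage_isClosed_of_isClosed isClosed_Icc (isClosed_Ici (a := M'))
      exact this
    have hAne : A.Nonempty := ⟨t1, ht1, hlt.le⟩
    have hbd : BddBelow A := ⟨0, fun t ht => ht.1.1⟩
    have hmem := hAc.csInf_mem hAne hbd
    set τ := sInf A
    have hin : ∀ t ∈ Icc 0 τ, ‖y t‖ ≤ M' := by
      have h1 : ∀ t ∈ Ico 0 τ, ‖y t‖ ≤ M' := by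
        intro t ht
        by_contra! hc
        have : t ∈ A := ⟨⟨ht.1, ht.2.le.trans hmem.1.2⟩, hc.le⟩
        exact absurd (csInf_le hbd this) (not_le.2 ht.2)
      have hτ0 : 0 < τ := by
        rcases hmem.1.1.lt_or_eq with h | h
        · exact h
        · exfalso
          have := hmem.2
          change M' ≤ ‖y τ‖ at this
          rw [← h, y0, hM'] at this
          linarith [le_max_right M ‖(a, b, c)‖]
      intro t ht
      rcases ht.2.lt_or_eq with h | h
      · exact h1 t ⟨ht.1, h⟩
      · subst h
        have hc : ContinuousWithinAt (fun t => ‖y t‖) (Ico 0 τ) τ :=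
          (cy.norm τ hmem.1).mono (fun s hs => ⟨hs.1, hs.2.le.trans hmem.1.2⟩)
        have hcl : τ ∈ closure (Ico 0 τ) := by
          rw [closure_Ico hτ0.ne]; exact ⟨hτ0.le, le_rfl⟩
        have := hc.mem_closure (t := Iic M') hcl (fun s hs => h1 s hs)
        simpa using this
    have HS : FS β a b c τ _ _ _ := FS.of_vec y0 (β := β) (T := τ) (fun t ht => by
      rw [← hW]
      · exact hy t ⟨ht.1, ht.2.trans hmem.1.2⟩
      · simpa using hin t ht)
    have h3 := hM τ hmem.1 _ _ _ HS
    have h4 : ‖y τ‖ ≤ M := by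
      simp only [Prod.norm_def, Real.norm_eq_abs, max_le_iff]
      exact h3
    have h5 : M' ≤ ‖y τ‖ := hmem.2
    linarith [le_max_left M ‖(a, b, c)‖]
  exact ⟨_, _, _, FS.of_vec y0 (β := β) (T := T) (fun t ht => by
      rw [← hW]
      · exact hy t ht
      · simpa using key t ht)⟩

lemma FS.global {β a b c : ℝ}
    (hfin : ∀ T : ℝ, 0 ≤ T → ∃ f g h, FS β a b c T f g h) :
    ∃ F, IsSolWithParam β a b c F := by
  choose! f g h H using hfin
  have agree : ∀ T T' : ℝ, 0 ≤ T → T ≤ T' → ∀ t ∈ Icc 0 T, f T t = f T' t ∧ g T t = g T' t ∧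
      h T t = h T' t := fun T T' hT hTT => (H T hT).unique ((H T' (hT.trans hTT)).mono hTT)
  -- glued functions
  let f1 : ℝ → ℝ := fun t => f (t + 1) t
  let g1 : ℝ → ℝ := fun t => g (t + 1) t
  let h1 : ℝ → ℝ := fun t => h (t + 1) t
  have gl : ∀ T, 0 ≤ T → ∀ t ∈ Icc 0 (T + 1), f1 t = f (T + 1) t ∧ g1 t = g (T + 1) t ∧ h1 t = h (T + 1) t := by
    intro T hT t ht
    rcases le_total T t with h | h
    · obtain ⟨e1, e2, e3⟩ := agree (T+1) (t + 1) (by linarith) (by linarith) t ht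
      exact ⟨e1.symm, e2.symm, e3.symm⟩
    · exact agree (t+1) (T + 1) (by linarith [ht.1]) (by linarith) t ⟨ht.1, by linarith⟩
  have D : ∀ t, 0 ≤ t → HasDerivWithinAt f1 (g1 t) (Ici 0) t ∧ HasDerivWithinAt g1 (h1 t) (Ici 0) t ∧
      HasDerivWithinAt h1 (-(f1 t * h1 t) - β * g1 t * (g1 t - 1)) (Ici 0) t := by
    intro t ht
    have hmem : t ∈ Icc 0 (t + 1) := ⟨ht, by linarith⟩
    have hS := H (t + 1) (by linarith)
    obtain ⟨e1, e2, e3⟩ := gl t ht t hmem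
    have hev : ∀ᶠ s in 𝓝[Ici 0] t, s ∈ Icc 0 (t + 1) := by
      filter_upwards [self_mem_nhdsWithin, mem_nhdsWithin_of_mem_nhds (Iio_mem_nhds (show t < t + 1 by linarith))] with s hs hs'
      exact ⟨hs, (mem_Iio.1 hs').le⟩
    refine ⟨?_, ?_, ?_⟩
    · rw [e2]
      exact (hS.df t hmem).hasDerivWithinAt.congr_of_eventuallyEq
        (hev.mono fun s hs => (gl t ht s hs).1) e1
    · rw [e3]
      exact (hS.dg t hmem).hasDerivWithinAt.congr_of_eventuallyEq
        (hev.mono fun s hs => (gl t ht s hs).2.1) e2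
    · rw [e1, e2, e3]
      exact (hS.dh t hmem).hasDerivWithinAt.congr_of_eventuallyEq
        (hev.mono fun s hs => (gl t ht s hs).2.2) e3
  have hS1 := H (0 + 1) (by norm_num)
  have i0 : f1 0 = a := hS1.f0
  have i1 : g1 0 = b := hS1.g0
  have i2 : h1 0 = c := hS1.h0
  let k : ℝ → ℝ := fun t => -(f1 (max t 0) * h1 (max t 0)) - β * g1 (max t 0) * (g1 (max t 0) - 1)
  have cmax : Continuous (fun t : ℝ => max t 0) := by fun_prop
  have cont : ∀ u : ℝ → ℝ, ContinuousOn u (Ici 0) → Continuous (fun t => u (max t 0)) :=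
    fun u hu => hu.comp_continuous cmax (fun t => by simp)
  have cf := cont f1 (fun t ht => (D t ht).1.continuousWithinAt)
  have cg := cont g1 (fun t ht => (D t ht).2.1.continuousWithinAt)
  have ch := cont h1 (fun t ht => (D t ht).2.2.continuousWithinAt)
  have ck : Continuous k := by
    exact ((cf.mul ch).neg).sub ((continuous_const.mul cg).mul (cg.sub continuous_const))
  have step : ∀ (x : ℝ) (u : ℝ → ℝ) (hu : Continuous u) (t : ℝ),
      HasDerivAt (fun t => x + ∫ s in (0:ℝ)..t, u s) (u t) t := by
    intro x u hu t
    exact (intervalIntegral.integral_hasDerivAt_right (hu.intervalIntegrable _ _)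
      hu.stronglyMeasurable.stronglyMeasurableAtFilter hu.continuousAt).const_add x
  let F2 : ℝ → ℝ := fun t => c + ∫ s in (0:ℝ)..t, k s
  have d2 : ∀ t, HasDerivAt F2 (k t) t := step c k ck
  have c2 : Continuous F2 := continuous_iff_continuousAt.2 fun t => (d2 t).continuousAt
  let F1 : ℝ → ℝ := fun t => b + ∫ s in (0:ℝ)..t, F2 s
  have d1 : ∀ t, HasDerivAt F1 (F2 t) t := step b F2 c2
  have c1 : Continuous F1 := continuous_iff_continuousAt.2 fun t => (d1 t).continuousAt
  let F0 : ℝ → ℝ := fun t => a + ∫ s in (0:ℝ)..t, F1 s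
  have d0 : ∀ t, HasDerivAt F0 (F1 t) t := step a F1 c1
  -- equality on [0,∞)
  have eqn : ∀ (u v u' : ℝ → ℝ), (∀ t, 0 ≤ t → HasDerivWithinAt u (u' t) (Ici 0) t) →
      (∀ t, 0 ≤ t → HasDerivAt v (u' t) t) → u 0 = v 0 → ∀ t, 0 ≤ t → u t = v t := by
    intro u v u' hu hv h0 t ht
    have := eq_of_has_deriv_right_eq (f := u) (g := v) (f' := u') (a := 0) (b := t)
      (fun s hs => (hu s hs.1).mono (Ici_subset_Ici.2 hs.1))
      (fun s hs => (hv s hs.1).hasDerivWithinAt)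
      (fun s hs => (hu s hs.1).continuousWithinAt.mono Icc_subset_Ici_self)
      (fun s hs => (hv s hs.1).continuousAt.continuousWithinAt) h0
    exact this t ⟨ht, le_rfl⟩
  have E2 : ∀ t, 0 ≤ t → h1 t = F2 t := eqn h1 F2 k
    (fun t ht => by simpa [k, ht] using (D t ht).2.2) (fun t _ => d2 t) (by simp [F2, i2])
  have E1 : ∀ t, 0 ≤ t → g1 t = F1 t := eqn g1 F1 h1
    (fun t ht => (D t ht).2.1) (fun t ht => by rw [E2 t ht]; exact d1 t) (by simp [F1, i1])
  have E0 : ∀ t, 0 ≤ t → f1 t = F0 t := eqn f1 F0 g1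
    (fun t ht => (D t ht).1) (fun t ht => by rw [E1 t ht]; exact d0 t) (by simp [F0, i0])
  have D0 : deriv F0 = F1 := funext fun t => (d0 t).deriv
  have D1 : deriv F1 = F2 := funext fun t => (d1 t).deriv
  have D2 : deriv F2 = k := funext fun t => (d2 t).deriv
  refine ⟨F0, ?_, ?_, by simp [F0], by rw [D0]; simp [F1], by rw [D0, D1]; simp [F2]⟩
  · have C2 : ContDiff ℝ 1 F2 := contDiff_one_iff_deriv.2 ⟨fun t => (d2 t).differentiableAt, by rw [D2]; exact ck⟩
    have C1 : ContDiff ℝ 2 F1 := by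
      rw [show (2 : WithTop ℕ∞) = 1 + 1 by norm_num, contDiff_succ_iff_deriv]
      exact ⟨fun t => (d1 t).differentiableAt, by simp, by rw [D1]; exact C2⟩
    rw [show (3 : WithTop ℕ∞) = 2 + 1 by norm_num, contDiff_succ_iff_deriv]
    exact ⟨fun t => (d0 t).differentiableAt, by simp, by rw [D0]; exact C1⟩
  · intro t ht
    rw [D0, D1, D2]
    have ht : 0 ≤ t := ht
    simp only [k, max_eq_left ht, E0 t ht, E1 t ht, E2 t ht]
    ring

lemma IsSolWithParam.fs {β a b c : ℝ} {F : ℝ → ℝ} (H : IsSolWithParam β a b c F) (T : ℝ) :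
    FS β a b c T F (deriv F) (deriv (deriv F)) := by
  obtain ⟨hc, he, h0, h1, h2⟩ := H
  rw [show (3 : WithTop ℕ∞) = 2 + 1 by norm_num, contDiff_succ_iff_deriv] at hc
  obtain ⟨a1, -, hc⟩ := hc
  rw [show (2 : WithTop ℕ∞) = 1 + 1 by norm_num, contDiff_succ_iff_deriv] at hc
  obtain ⟨a2, -, hc⟩ := hc
  have a3 := (contDiff_one_iff_deriv.1 hc).1
  refine ⟨fun t _ => (a1 t).hasDerivAt, fun t _ => (a2 t).hasDerivAt, fun t ht => ?_, h0, h1, h2⟩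
  have e := he t ht.1
  have e' : -(F t * deriv (deriv F) t) - β * deriv F t * (deriv F t - 1) =
      deriv (deriv (deriv F)) t := by linear_combination -e
  rw [e']
  exact (a3 t).hasDerivAt


lemma first_zero {g : ℝ → ℝ} {s T : ℝ} (hg : ContinuousOn g (Icc s T)) (hsT : s ≤ T)
    (h0 : 0 < g s) (h1 : g T ≤ 0) : ∃ t₁ ∈ Ioc s T, g t₁ = 0 ∧ ∀ t ∈ Ico s t₁, 0 < g t := by
  let A := Icc s T ∩ {t | g t ≤ 0}
  have hAc : IsClosed A := hg.preimage_isClosed_of_isClosed isClosed_Icc (isClosed_Iic (a := 0))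
  have hbd : BddBelow A := ⟨s, fun t ht => ht.1.1⟩
  have hmem := hAc.csInf_mem ⟨T, ⟨hsT, le_rfl⟩, h1⟩ hbd
  set τ := sInf A
  have hle : g τ ≤ 0 := hmem.2
  have hlt : s < τ := by
    rcases hmem.1.1.lt_or_eq with h | h
    · exact h
    · rw [← h] at hle; linarith
  have hpos : ∀ t ∈ Ico s τ, 0 < g t := by
    intro t ht
    by_contra! hc
    have : t ∈ A := ⟨⟨ht.1, ht.2.le.trans hmem.1.2⟩, hc⟩
    exact absurd (csInf_le hbd this) (not_le.2 ht.2)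
  refine ⟨τ, ⟨hlt, hmem.1.2⟩, le_antisymm hle ?_, hpos⟩
  have hc : ContinuousWithinAt g (Ico s τ) τ :=
    (hg τ hmem.1).mono (fun r hr => ⟨hr.1, hr.2.le.trans hmem.1.2⟩)
  have hcl : τ ∈ closure (Ico s τ) := by
    rw [closure_Ico hlt.ne]; exact ⟨hlt.le, le_rfl⟩
  have := hc.mem_closure (t := Ici 0) hcl (fun r hr => (hpos r hr).le)
  simpa using this

lemma mono_of {x x' : ℝ → ℝ} {s T : ℝ} (hx : ContinuousOn x (Icc s T))
    (hd : ∀ t ∈ Ioo s T, HasDerivAt x (x' t) t) (hp : ∀ t ∈ Ioo s T, 0 ≤ x' t) :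
    MonotoneOn x (Icc s T) := by
  apply monotoneOn_of_deriv_nonneg (convex_Icc s T) hx
  · rw [interior_Icc]; exact fun t ht => (hd t ht).differentiableAt.differentiableWithinAt
  · rw [interior_Icc]; intro t ht; rw [(hd t ht).deriv]; exact hp t ht

lemma smono_of {x x' : ℝ → ℝ} {s T : ℝ} (hx : ContinuousOn x (Icc s T))
    (hd : ∀ t ∈ Ioo s T, HasDerivAt x (x' t) t) (hp : ∀ t ∈ Ioo s T, 0 < x' t) :
    StrictMonoOn x (Icc s T) := by
  apply strictMonoOn_of_deriv_pos (convex_Icc s T) hx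
  rw [interior_Icc]; intro t ht; rw [(hd t ht).deriv]; exact hp t ht

lemma anti_of {x x' : ℝ → ℝ} {s T : ℝ} (hx : ContinuousOn x (Icc s T))
    (hd : ∀ t ∈ Ioo s T, HasDerivAt x (x' t) t) (hp : ∀ t ∈ Ioo s T, x' t ≤ 0) :
    AntitoneOn x (Icc s T) := by
  have := mono_of hx.neg (fun t ht => (hd t ht).neg) (fun t ht => by linarith [hp t ht])
  intro a ha b hb hab
  have := this ha hb hab
  simp at this; exact this

lemma santi_of {x x' : ℝ → ℝ} {s T : ℝ} (hx : ContinuousOn x (Icc s T))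
    (hd : ∀ t ∈ Ioo s T, HasDerivAt x (x' t) t) (hp : ∀ t ∈ Ioo s T, x' t < 0) :
    StrictAntiOn x (Icc s T) := by
  have := smono_of hx.neg (fun t ht => (hd t ht).neg) (fun t ht => by linarith [hp t ht])
  intro a ha b hb hab
  have := this ha hb hab
  simp at this; exact this

lemma exp_deriv (K s t : ℝ) : HasDerivAt (fun t => Real.exp (K * (t - s))) (K * Real.exp (K * (t - s))) t := by
  have := (((hasDerivAt_id t).sub_const s).const_mul K).exp
  simpa [mul_comm] using! this

/-- cooperative comparison -/
lemma coop {x z x' z' p r : ℝ → ℝ} {s T : ℝ} (hx : ContinuousOn x (Icc s T))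
    (hz : ContinuousOn z (Icc s T)) (hp : ContinuousOn p (Icc s T)) (hr : ContinuousOn r (Icc s T))
    (dx : ∀ t ∈ Ioo s T, HasDerivAt x (x' t) t) (dz : ∀ t ∈ Ioo s T, HasDerivAt z (z' t) t)
    (ix : ∀ t ∈ Ioo s T, p t * x t + z t ≤ x' t) (iz : ∀ t ∈ Ioo s T, r t * x t ≤ z' t)
    (r0 : ∀ t ∈ Icc s T, 0 ≤ r t) (x0 : 0 ≤ x s) (z0 : 0 ≤ z s) :
    ∀ t ∈ Icc s T, 0 ≤ x t ∧ 0 ≤ z t := by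
  obtain ⟨K1, hK1⟩ := isCompact_Icc.exists_bound_of_continuousOn hp
  obtain ⟨K2, hK2⟩ := isCompact_Icc.exists_bound_of_continuousOn hr
  simp only [Real.norm_eq_abs] at hK1 hK2
  set N := |K1| + |K2| + 2 with hN
  have n1 := le_abs_self K1
  have n2 := le_abs_self K2
  have n3 := abs_nonneg K1
  have n4 := abs_nonneg K2
  have main : ∀ ε > 0, ∀ t ∈ Icc s T, 0 < x t + ε * Real.exp (N * (t - s)) ∧
      0 < z t + ε * Real.exp (N * (t - s)) := by
    intro ε hε t ht
    set X : ℝ → ℝ := fun t => x t + ε * Real.exp (N * (t - s)) with hX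
    set Z : ℝ → ℝ := fun t => z t + ε * Real.exp (N * (t - s)) with hZ
    have cX : ContinuousOn X (Icc s T) := hx.add (by fun_prop)
    have cZ : ContinuousOn Z (Icc s T) := hz.add (by fun_prop)
    by_contra hcon
    have hsub : Icc s t ⊆ Icc s T := Icc_subset_Icc le_rfl ht.2
    have hmin : min (X t) (Z t) ≤ 0 := by
      by_contra! h; rw [lt_min_iff] at h; exact hcon h
    have hX0 : 0 < X s := by simp [hX]; linarith
    have hZ0 : 0 < Z s := by simp [hZ]; linarith
    obtain ⟨t1, ht1, e1, hpos⟩ := first_zero (g := fun t => min (X t) (Z t))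
      (ContinuousOn.inf (cX.mono hsub) (cZ.mono hsub)) ht.1 (lt_min hX0 hZ0) hmin
    have hT1 : t1 ≤ T := ht1.2.trans ht.2
    have sub1 : Icc s t1 ⊆ Icc s T := Icc_subset_Icc le_rfl hT1
    have sub2 : Ioo s t1 ⊆ Ioo s T := Ioo_subset_Ioo le_rfl hT1
    have dX : ∀ u ∈ Ioo s t1, HasDerivAt X (x' u + ε * (N * Real.exp (N * (u - s)))) u :=
      fun u hu => (dx u (sub2 hu)).add ((exp_deriv N s u).const_mul ε)
    have dZ : ∀ u ∈ Ioo s t1, HasDerivAt Z (z' u + ε * (N * Real.exp (N * (u - s)))) u :=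
      fun u hu => (dz u (sub2 hu)).add ((exp_deriv N s u).const_mul ε)
    have XZ : ∀ u ∈ Ioo s t1, 0 < X u ∧ 0 < Z u := fun u hu =>
      lt_min_iff.1 (hpos u ⟨hu.1.le, hu.2⟩)
    have aX : 0 < X t1 := by
      have hm := mono_of (x := fun u => X u * Real.exp (|K1| * (u - s)))
        ((cX.mono sub1).mul (by fun_prop)) (fun u hu => (dX u hu).mul (exp_deriv _ s u))
        (fun u hu => by
          have i := ix u (sub2 hu)
          have b1 := hK1 u (Ioo_subset_Icc_self (sub2 hu))
          have b2 := abs_le.1 b1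
          obtain ⟨q1, q2⟩ := XZ u hu
          have e0 := Real.exp_pos (N * (u - s))
          have : 0 ≤ x' u + ε * (N * Real.exp (N * (u - s))) + X u * |K1| := by
            simp only [hX, hZ] at q1 q2 ⊢
            set E := ε * Real.exp (N * (u - s))
            have hE : 0 < E := by positivity
            have : ε * (N * Real.exp (N * (u - s))) = N * E := by simp only [E]; ring
            rw [this]
            nlinarith
          have e1 := Real.exp_pos (|K1| * (u - s))
          nlinarith [mul_nonneg this e1.le])
      have := hm ⟨le_rfl, ht1.1.le⟩ ⟨ht1.1.le, le_rfl⟩ ht1.1.le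
      simp at this
      have e1 := Real.exp_pos (|K1| * (t1 - s))
      by_contra! hc
      nlinarith
    have aZ : 0 < Z t1 := by
      have hm := mono_of (cZ.mono sub1) dZ
        (fun u hu => by
          have i := iz u (sub2 hu)
          have b1 := hK2 u (Ioo_subset_Icc_self (sub2 hu))
          have b2 := abs_le.1 b1
          have b3 := r0 u (Ioo_subset_Icc_self (sub2 hu))
          obtain ⟨q1, q2⟩ := XZ u hu
          have e0 := Real.exp_pos (N * (u - s))
          simp only [hX, hZ] at q1 q2 ⊢
          set E := ε * Real.exp (N * (u - s))
          have hE : 0 < E := by positivity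
          have : ε * (N * Real.exp (N * (u - s))) = N * E := by simp only [E]; ring
          rw [this]
          nlinarith [mul_nonneg b3 q1.le])
      have := hm ⟨le_rfl, ht1.1.le⟩ ⟨ht1.1.le, le_rfl⟩ ht1.1.le
      linarith
    have := lt_min aX aZ
    linarith
  intro t ht
  have aux : ∀ v : ℝ, (∀ ε > 0, 0 < v + ε * Real.exp (N * (t - s))) → 0 ≤ v := by
    intro v hv
    by_contra! hc
    have e0 := Real.exp_pos (N * (t - s))
    have := hv (-v / Real.exp (N * (t - s))) (by apply div_pos <;> linarith)
    rw [div_mul_cancel₀ _ e0.ne'] at this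
    linarith
  exact ⟨aux _ fun ε hε => (main ε hε t ht).1, aux _ fun ε hε => (main ε hε t ht).2⟩

lemma scal_mono {x x' p : ℝ → ℝ} {s T : ℝ} (hx : ContinuousOn x (Icc s T))
    (hp : ContinuousOn p (Icc s T))
    (dx : ∀ t ∈ Ioo s T, HasDerivAt x (x' t) t)
    (ix : ∀ t ∈ Ioo s T, p t * x t ≤ x' t) (xn : ∀ t ∈ Icc s T, 0 ≤ x t) :
    ∃ K, MonotoneOn (fun u => x u * Real.exp (K * (u - s))) (Icc s T) ∧
      ((∀ t ∈ Ioo s T, p t * x t < x' t) →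
        StrictMonoOn (fun u => x u * Real.exp (K * (u - s))) (Icc s T)) := by
  obtain ⟨K1, hK1⟩ := isCompact_Icc.exists_bound_of_continuousOn hp
  simp only [Real.norm_eq_abs] at hK1
  refine ⟨K1, mono_of (hx.mul (by fun_prop)) (fun u hu => (dx u hu).mul (exp_deriv _ s u)) ?_,
    fun ix' => smono_of (hx.mul (by fun_prop)) (fun u hu => (dx u hu).mul (exp_deriv _ s u)) ?_⟩
  · intro u hu
    have b2 := abs_le.1 (hK1 u (Ioo_subset_Icc_self hu))
    have e1 := Real.exp_pos (K1 * (u - s))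
    have := ix u hu
    have q := xn u (Ioo_subset_Icc_self hu)
    have : 0 ≤ x' u + x u * K1 := by nlinarith
    nlinarith [mul_nonneg this e1.le]
  · intro u hu
    have b2 := abs_le.1 (hK1 u (Ioo_subset_Icc_self hu))
    have e1 := Real.exp_pos (K1 * (u - s))
    have := ix' u hu
    have q := xn u (Ioo_subset_Icc_self hu)
    have : 0 < x' u + x u * K1 := by nlinarith
    nlinarith [mul_pos this e1]

lemma scal {x x' p : ℝ → ℝ} {s T : ℝ} (hx : ContinuousOn x (Icc s T))
    (hp : ContinuousOn p (Icc s T))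
    (dx : ∀ t ∈ Ioo s T, HasDerivAt x (x' t) t)
    (ix : ∀ t ∈ Ioo s T, p t * x t ≤ x' t) (x0 : 0 ≤ x s) :
    ∀ t ∈ Icc s T, 0 ≤ x t := by
  intro t ht
  exact (coop (z := fun _ => 0) (z' := fun _ => 0) (r := fun _ => 0) hx continuousOn_const hp
    continuousOn_const dx (fun t _ => hasDerivAt_const t 0) (by simpa using ix) (by simp) (by simp)
    x0 le_rfl t ht).1

lemma scal_pos {x x' p : ℝ → ℝ} {s T : ℝ} (hx : ContinuousOn x (Icc s T))
    (hp : ContinuousOn p (Icc s T))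
    (dx : ∀ t ∈ Ioo s T, HasDerivAt x (x' t) t)
    (ix : ∀ t ∈ Ioo s T, p t * x t ≤ x' t) (x0 : 0 < x s) :
    ∀ t ∈ Icc s T, 0 < x t := by
  intro t ht
  obtain ⟨K, hm, -⟩ := scal_mono hx hp dx ix (scal hx hp dx ix x0.le)
  have := hm ⟨le_rfl, ht.1.trans ht.2⟩ ht ht.1
  simp at this
  by_contra! hc
  nlinarith [Real.exp_pos (K * (t - s))]

lemma scal_strict {x x' p : ℝ → ℝ} {s T : ℝ} (hx : ContinuousOn x (Icc s T))
    (hp : ContinuousOn p (Icc s T))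
    (dx : ∀ t ∈ Ioo s T, HasDerivAt x (x' t) t)
    (ix : ∀ t ∈ Ioo s T, p t * x t < x' t) (x0 : 0 ≤ x s) :
    ∀ t ∈ Ioc s T, 0 < x t := by
  intro t ht
  have ix' := fun t ht => (ix t ht).le
  obtain ⟨K, -, hm⟩ := scal_mono hx hp dx ix' (scal hx hp dx ix' x0)
  have := hm ix ⟨le_rfl, ht.1.le.trans ht.2⟩ ⟨ht.1.le, ht.2⟩ ht.1
  simp at this
  by_contra! hc
  nlinarith [Real.exp_pos (K * (t - s))]

/-- a function with derivative at most `-δ` past `T₀` -/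
lemma lin_dec {g h : ℝ → ℝ} {T₀ δ : ℝ} (dg : ∀ t ≥ T₀, HasDerivAt g (h t) t)
    (hh : ∀ t ≥ T₀, h t ≤ -δ) : ∀ t ≥ T₀, g t ≤ g T₀ - δ * (t - T₀) := by
  intro t ht
  have := anti_of (x := fun t => g t + δ * t) (s := T₀) (T := t)
    (fun u hu => ((dg u hu.1).continuousAt.continuousWithinAt).add (by fun_prop))
    (fun u hu => (dg u hu.1.le).add ((hasDerivAt_id u).const_mul δ))
    (fun u hu => by linarith [hh u hu.1.le]) ⟨le_rfl, ht⟩ ⟨ht, le_rfl⟩ ht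
  simp only at this
  linarith

lemma no_lin_dec {g h : ℝ → ℝ} {T₀ δ B : ℝ} (hδ : 0 < δ) (dg : ∀ t ≥ T₀, HasDerivAt g (h t) t)
    (hh : ∀ t ≥ T₀, h t ≤ -δ) (hB : ∀ t ≥ T₀, B < g t) : False := by
  have h0 := hB T₀ le_rfl
  have hp : 0 ≤ (g T₀ - B) / δ := div_nonneg (by linarith) hδ.le
  have h1 := lin_dec dg hh (T₀ + (g T₀ - B) / δ) (by linarith)
  have h2 := hB (T₀ + (g T₀ - B) / δ) (by linarith)
  have : δ * (T₀ + (g T₀ - B) / δ - T₀) = g T₀ - B := by field_simp; ring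
  linarith

lemma tendsto_div_of_deriv {u u' : ℝ → ℝ} {l : ℝ} (du : ∀ t ≥ 0, HasDerivAt u (u' t) t)
    (hl : Tendsto u' atTop (𝓝 l)) : Tendsto (fun t => u t / t) atTop (𝓝 l) := by
  rw [Metric.tendsto_atTop] at hl ⊢
  intro ε hε
  obtain ⟨N, hN⟩ := hl (ε / 2) (by positivity)
  set T := max N 1
  have T1 : 1 ≤ T := le_max_right _ _
  have hT : ∀ t ≥ T, |u' t - l| < ε / 2 := fun t ht => by
    simpa [Real.dist_eq] using hN t ((le_max_left _ _).trans ht)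
  have up := lin_dec (g := fun t => u t - l * t) (h := fun t => u' t - l) (T₀ := T) (δ := -(ε/2))
    (fun t ht => by simpa using! (du t (by linarith)).sub ((hasDerivAt_id t).const_mul l))
    (fun t ht => by linarith [abs_lt.1 (hT t ht)])
  have lo := lin_dec (g := fun t => l * t - u t) (h := fun t => l - u' t) (T₀ := T) (δ := -(ε/2))
    (fun t ht => by simpa using! ((hasDerivAt_id t).const_mul l).sub (du t (by linarith)))
    (fun t ht => by linarith [abs_lt.1 (hT t ht)])
  set C := |u T - l * T|
  refine ⟨max T (2 * (C + 1) / ε), fun t ht => ?_⟩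
  have t1 : T ≤ t := (le_max_left _ _).trans ht
  have t2 : 2 * (C + 1) / ε ≤ t := (le_max_right _ _).trans ht
  rw [div_le_iff₀ hε] at t2
  have t0 : 0 < t := by linarith
  have q1 := up t t1
  have q2 := lo t t1
  have c1 := le_abs_self (u T - l * T)
  have c2 := neg_abs_le (u T - l * T)
  rw [Real.dist_eq, show u t / t - l = (u t - l * t) / t by field_simp, abs_div, abs_of_pos t0,
    div_lt_iff₀ t0, abs_lt]
  constructor <;> nlinarith

lemma limit_one {β l : ℝ} {f g h : ℝ → ℝ} (hβ : 0 < β) (hl : 0 < l)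
    (df : ∀ t ≥ 0, HasDerivAt f (g t) t) (dg : ∀ t ≥ 0, HasDerivAt g (h t) t)
    (dh : ∀ t ≥ 0, HasDerivAt h (-(f t * h t) - β * g t * (g t - 1)) t)
    (hg : Tendsto g atTop (𝓝 l)) : l = 1 := by
  have dJ : ∀ t ≥ 0, HasDerivAt (fun t => h t + f t * g t) ((1 - β) * (g t)^2 + β * g t) t := by
    intro t ht
    have := (dh t ht).add ((df t ht).mul (dg t ht))
    refine this.congr_deriv ?_
    ring
  have a1 := tendsto_div_of_deriv dJ (l := (1 - β) * l^2 + β * l)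
    (((hg.pow 2).const_mul _).add (hg.const_mul _))
  have a2 := tendsto_div_of_deriv df hg
  have a3 := a1.sub (a2.mul hg)
  have a4 : Tendsto (fun t => h t / t) atTop (𝓝 (β * l * (1 - l))) := by
    have e : (1 - β) * l^2 + β * l - l * l = β * l * (1 - l) := by ring
    rw [e] at a3
    refine a3.congr fun t => ?_
    ring
  by_contra hne
  rcases lt_or_gt_of_ne hne with h1 | h1
  · have k : 0 < β * l * (1 - l) := mul_pos (mul_pos hβ hl) (by linarith)
    have ev := (a4.eventually (lt_mem_nhds (half_lt_self k))).and
      ((hg.eventually (gt_mem_nhds (show l < l + 1 by linarith))).and (eventually_ge_atTop 1))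
    obtain ⟨T, hT⟩ := eventually_atTop.1 ev
    refine no_lin_dec (g := fun t => - g t) (h := fun t => - h t) (T₀ := max T 1)
      (B := -(l + 1)) (half_pos k) (fun t ht => (dg t ?_).neg) (fun t ht => ?_) (fun t ht => ?_)
    · linarith [le_max_right T 1]
    · obtain ⟨q1, q2, q3⟩ := hT t ((le_max_left _ _).trans ht)
      rw [lt_div_iff₀ (by linarith)] at q1
      nlinarith
    · obtain ⟨q1, q2, q3⟩ := hT t ((le_max_left _ _).trans ht)
      linarith
  · have k : 0 < -(β * l * (1 - l)) := by nlinarith [mul_pos hβ hl]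
    have ev := (a4.eventually (gt_mem_nhds (show β * l * (1 - l) < β * l * (1 - l) / 2 by linarith))).and
      ((hg.eventually (lt_mem_nhds (show l - 1 < l by linarith))).and (eventually_ge_atTop 1))
    obtain ⟨T, hT⟩ := eventually_atTop.1 ev
    refine no_lin_dec (g := g) (h := h) (T₀ := max T 1)
      (B := l - 1) (half_pos k) (fun t ht => dg t ?_) (fun t ht => ?_) (fun t ht => ?_)
    · linarith [le_max_right T 1]
    · obtain ⟨q1, q2, q3⟩ := hT t ((le_max_left _ _).trans ht)
      rw [div_lt_iff₀ (by linarith)] at q1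
      nlinarith
    · obtain ⟨q1, q2, q3⟩ := hT t ((le_max_left _ _).trans ht)
      linarith


section basic
variable {β a b c T : ℝ} {f g h : ℝ → ℝ}

lemma FS.cf (H : FS β a b c T f g h) : ContinuousOn f (Icc 0 T) :=
  fun t ht => (H.df t ht).continuousAt.continuousWithinAt
lemma FS.cg (H : FS β a b c T f g h) : ContinuousOn g (Icc 0 T) :=
  fun t ht => (H.dg t ht).continuousAt.continuousWithinAt
lemma FS.ch (H : FS β a b c T f g h) : ContinuousOn h (Icc 0 T) :=
  fun t ht => (H.dh t ht).continuousAt.continuousWithinAt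

lemma FS.dJ (H : FS β a b c T f g h) : ∀ t ∈ Icc 0 T,
    HasDerivAt (fun t => h t + f t * g t) ((1 - β) * (g t)^2 + β * g t) t := by
  intro t ht
  have := (H.dh t ht).add ((H.df t ht).mul (H.dg t ht))
  refine this.congr_deriv ?_
  ring

lemma FS.dH (H : FS β a b c T f g h) : ∀ t ∈ Icc 0 T,
    HasDerivAt (fun t => h t + f t * (g t - 1)) ((1 - β) * g t * (g t - 1)) t := by
  intro t ht
  have := (H.dh t ht).add ((H.df t ht).mul ((H.dg t ht).sub_const 1))
  refine this.congr_deriv ?_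
  ring

lemma FS.f_mono (H : FS β a b c T f g h) (hg : ∀ t ∈ Icc 0 T, 0 ≤ g t) :
    MonotoneOn f (Icc 0 T) :=
  mono_of H.cf (fun t ht => H.df t (Ioo_subset_Icc_self ht))
    (fun t ht => hg t (Ioo_subset_Icc_self ht))

lemma FS.f_ge (H : FS β a b c T f g h) (hg : ∀ t ∈ Icc 0 T, 0 ≤ g t) :
    ∀ t ∈ Icc 0 T, a ≤ f t := by
  intro t ht
  have := H.f_mono hg ⟨le_rfl, ht.1.trans ht.2⟩ ht ht.1
  rwa [H.f0] at this

lemma FS.J_mono (hβ1 : 0 < β) (hβ2 : β ≤ 1) (H : FS β a b c T f g h)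
    (hg : ∀ t ∈ Icc 0 T, 0 ≤ g t) :
    MonotoneOn (fun t => h t + f t * g t) (Icc 0 T) :=
  mono_of (H.ch.add (H.cf.mul H.cg)) (fun t ht => H.dJ t (Ioo_subset_Icc_self ht))
    (fun t ht => by
      have := hg t (Ioo_subset_Icc_self ht)
      have : 0 ≤ (1 - β) * (g t)^2 := mul_nonneg (by linarith) (sq_nonneg _)
      nlinarith)

lemma FS.J_mono' (hβ2 : β ≤ 1) (H : FS β a b c T f g h) :
    MonotoneOn (fun t => h t + f t * g t - β * f t) (Icc 0 T) :=
  mono_of ((H.ch.add (H.cf.mul H.cg)).sub (continuousOn_const.mul H.cf))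
    (fun t ht => (H.dJ t (Ioo_subset_Icc_self ht)).sub
      ((H.df t (Ioo_subset_Icc_self ht)).const_mul β))
    (fun t ht => by
      have : 0 ≤ (1 - β) * (g t)^2 := mul_nonneg (by linarith) (sq_nonneg _)
      linarith)

lemma FS.ge_one' (hβ2 : β ≤ 1) (hb : 1 ≤ b)
    (hc : -(a * (b - 1)) ≤ c) (H : FS β a b c T f g h) (hg : ∀ t ∈ Icc 0 T, 0 ≤ g t) :
    ∀ t ∈ Icc 0 T, 1 ≤ g t := by
  intro t ht
  have := coop (x := fun t => g t - 1) (z := fun t => h t + f t * (g t - 1))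
    (p := fun t => - f t) (r := fun t => (1 - β) * g t) (s := 0) (T := T)
    (H.cg.sub continuousOn_const)
    (H.ch.add (H.cf.mul (H.cg.sub continuousOn_const))) H.cf.neg (continuousOn_const.mul H.cg)
    (fun t ht => (H.dg t (Ioo_subset_Icc_self ht)).sub_const 1)
    (fun t ht => H.dH t (Ioo_subset_Icc_self ht))
    (fun t _ => by linarith) (fun t _ => le_rfl)
    (fun t ht => mul_nonneg (by linarith) (hg t ht))
    (by rw [H.g0]; linarith) (by rw [H.h0, H.f0, H.g0]; linarith) t ht
  linarith [this.1]

lemma FS.ge_one (hβ2 : β ≤ 1) (hb : 1 ≤ b)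
    (hc : -(a * (b - 1)) ≤ c) (H : FS β a b c T f g h) :
    ∀ t ∈ Icc 0 T, 1 ≤ g t := by
  refine H.ge_one' hβ2 hb hc fun t ht => ?_
  by_contra! hn
  have sub : Icc 0 t ⊆ Icc 0 T := Icc_subset_Icc le_rfl ht.2
  obtain ⟨t1, ht1, e, hp⟩ := first_zero (H.cg.mono sub) ht.1 (by rw [H.g0]; linarith) hn.le
  have := (H.mono (ht1.2.trans ht.2)).ge_one' hβ2 hb hc (fun s hs => by
    rcases hs.2.lt_or_eq with h | h
    · exact (hp s ⟨hs.1, h⟩).le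
    · rw [h, e]) t1 ⟨ht1.1.le, le_rfl⟩
  linarith

end basic

def DD (β a b c : ℝ) : Prop := ∃ T f g h, 0 ≤ T ∧ FS β a b c T f g h ∧ g T < 0
def NA (β a b c : ℝ) : Prop := ∃ T f g h, 0 ≤ T ∧ FS β a b c T f g h ∧ g T < 1
def EE (β a b c : ℝ) : Prop := ∃ T f g h, 0 ≤ T ∧ FS β a b c T f g h ∧
  (∀ t ∈ Icc 0 T, 0 < g t) ∧ 0 < h T + f T * g T

lemma DD.na {β a b c : ℝ} (H : DD β a b c) : NA β a b c := by
  obtain ⟨T, f, g, h, hT, H, hg⟩ := H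
  exact ⟨T, f, g, h, hT, H, by linarith⟩

lemma NA.lt {β a b c : ℝ} (hβ2 : β ≤ 1) (hb : 1 ≤ b) (H : NA β a b c) : c < -(a * (b - 1)) := by
  obtain ⟨T, f, g, h, hT, H, hg⟩ := H
  by_contra! hc
  linarith [H.ge_one hβ2 hb hc T ⟨hT, le_rfl⟩]

lemma FS.apriori {β a b c T : ℝ} {f g h : ℝ → ℝ} (hβ1 : 0 < β) (hβ2 : β ≤ 1) (ha : 0 ≤ a)
    (hT : 0 ≤ T)
    (H : FS β a b c T f g h) (hg : ∀ t ∈ Icc 0 T, 0 ≤ g t) :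
    (h T ≤ |c| + T ∧ g T ≤ b + (|c| + T) * T ∧ f T ≤ a + (b + (|c| + T) * T) * T) ∧
      0 ≤ f T ∧ 0 ≤ g T ∧ c + a * b - f T * g T ≤ h T := by
  have hf := H.f_ge hg
  have hh : ∀ t ∈ Icc 0 T, h t ≤ |c| + t := by
    intro t ht
    have := scal (x := fun t => |c| + t - h t) (p := fun t => - f t) (s := 0) (T := T)
      ((by fun_prop : ContinuousOn (fun t => |c| + t) (Icc 0 T)).sub H.ch) H.cf.neg
      (fun t ht => (((hasDerivAt_id t).const_add |c|).sub (H.dh t (Ioo_subset_Icc_self ht))))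
      (fun t ht => by
        have h1 := hf t (Ioo_subset_Icc_self ht)
        have h2 : 0 ≤ f t * (|c| + t) := mul_nonneg (by linarith) (by linarith [ht.1, abs_nonneg c])
        have h3 : -1 ≤ β * g t * (g t - 1) := by nlinarith [sq_nonneg (g t - 1/2)]
        nlinarith) (by rw [H.h0]; linarith [le_abs_self c]) t ht
    linarith
  have hT' : T ∈ Icc 0 T := ⟨hT, le_rfl⟩
  have h0' : (0:ℝ) ∈ Icc 0 T := ⟨le_rfl, hT⟩
  have hc0 := abs_nonneg c
  have hgu : ∀ t ∈ Icc 0 T, g t ≤ b + (|c| + T) * T := by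
    intro t ht
    have := anti_of (x := fun t => g t - (|c| + T) * t) (H.cg.sub (by fun_prop))
      (fun t ht => (H.dg t (Ioo_subset_Icc_self ht)).sub ((hasDerivAt_id t).const_mul _))
      (fun t ht => by linarith [hh t (Ioo_subset_Icc_self ht), ht.2]) h0' ht ht.1
    simp [H.g0] at this
    have h3 := ht.2
    have : (|c| + T) * t ≤ (|c| + T) * T := by gcongr
    linarith
  have hfu : f T ≤ a + (b + (|c| + T) * T) * T := by
    have := anti_of (x := fun t => f t - (b + (|c| + T) * T) * t) (H.cf.sub (by fun_prop))
      (fun t ht => (H.df t (Ioo_subset_Icc_self ht)).sub ((hasDerivAt_id t).const_mul _))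
      (fun t ht => by linarith [hgu t (Ioo_subset_Icc_self ht)]) h0' hT' hT
    simp [H.f0] at this
    linarith
  refine ⟨⟨hh T hT', hgu T hT', hfu⟩, by linarith [hf T hT'], hg T hT', ?_⟩
  have := H.J_mono hβ1 hβ2 hg h0' hT' hT
  simp only [H.f0, H.g0, H.h0] at this
  linarith

lemma global_of_not_DD {β a b c : ℝ} (hβ1 : 0 < β) (hβ2 : β ≤ 1) (ha : 0 ≤ a) (hb : 1 ≤ b)
    (hD : ¬ DD β a b c) : ∃ F, IsSolWithParam β a b c F ∧ ∀ t ≥ 0, 0 < deriv F t := by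
  have key : ∀ T f g h, FS β a b c T f g h → ∀ t ∈ Icc 0 T, 0 ≤ g t := by
    intro T f g h H t ht
    by_contra! hn
    exact hD ⟨t, f, g, h, ht.1, H.mono ht.2, hn⟩
  obtain ⟨F, hF⟩ := FS.global (β := β) (a := a) (b := b) (c := c) (fun T hT => by
    set A := |c| + T
    set B := b + A * T
    set C := a + B * T
    have A0 : 0 ≤ A := by positivity
    have B0 : 0 ≤ B := by positivity
    have C0 : 0 ≤ C := by positivity
    refine FS.global_fin T (A + B + C + (|c + a * b| + C * B)) hT fun T' hT' f g h H => ?_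
    obtain ⟨⟨h1, h2, h3⟩, h4, h5, h6⟩ := H.apriori hβ1 hβ2 ha hT'.1 (key _ _ _ _ H)
    have l1 := hT'.1
    have l2 := hT'.2
    have A' : |c| + T' ≤ A := by simp only [A]; linarith
    have B' : b + (|c| + T') * T' ≤ B := by simp only [B]; gcongr
    have C' : a + (b + (|c| + T') * T') * T' ≤ C := by simp only [C]; gcongr
    have p1 : f T' * g T' ≤ C * B := by gcongr <;> linarith
    have p2 := neg_abs_le (c + a * b)
    have p3 := abs_nonneg (c + a * b)
    have p4 : 0 ≤ C * B := by positivity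
    refine ⟨?_, ?_, ?_⟩ <;> rw [abs_le] <;> constructor <;> linarith)
  refine ⟨F, hF, fun t ht => ?_⟩
  have H := hF.fs t
  have hnn := key _ _ _ _ H
  rcases (hnn t ⟨ht, le_rfl⟩).lt_or_eq with h | h
  · exact h
  exfalso
  -- interior minimum gives second derivative zero
  have H1 := hF.fs (t + 1)
  have hn1 := key _ _ _ _ H1
  have ht0 : 0 < t := by
    rcases ht.lt_or_eq with h' | h'
    · exact h'
    · rw [← h', H.g0] at h; linarith
  have hmin : IsLocalMin (deriv F) t := by
    filter_upwards [Ioo_mem_nhds ht0 (show t < t + 1 by linarith)] with s hs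
    rw [← h]; exact hn1 s ⟨hs.1.le, hs.2.le⟩
  have := H1.equil ⟨ht, by linarith⟩ h.symm hmin.deriv_eq_zero
  linarith

lemma DD_open {β a b c : ℝ} (H : DD β a b c) : ∃ δ > 0, ∀ c', |c' - c| < δ → DD β a b c' := by
  obtain ⟨T, f, g, h, hT, H, hg⟩ := H
  obtain ⟨δ, hδ, hc⟩ := H.cd hT (-(g T)) (by linarith)
  refine ⟨δ, hδ, fun c' hc' => ?_⟩
  obtain ⟨f', g', h', H', hcl⟩ := hc c' hc'
  have := abs_lt.1 (hcl T ⟨hT, le_rfl⟩).2.1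
  exact ⟨T, f', g', h', hT, H', by linarith⟩

lemma NA_open {β a b c : ℝ} (H : NA β a b c) : ∃ δ > 0, ∀ c', |c' - c| < δ → NA β a b c' := by
  obtain ⟨T, f, g, h, hT, H, hg⟩ := H
  obtain ⟨δ, hδ, hc⟩ := H.cd hT (1 -(g T)) (by linarith)
  refine ⟨δ, hδ, fun c' hc' => ?_⟩
  obtain ⟨f', g', h', H', hcl⟩ := hc c' hc'
  have := abs_lt.1 (hcl T ⟨hT, le_rfl⟩).2.1
  exact ⟨T, f', g', h', hT, H', by linarith⟩

lemma EE_open {β a b c : ℝ} (H : EE β a b c) : ∃ δ > 0, ∀ c', |c' - c| < δ → EE β a b c' := by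
  obtain ⟨T, f, g, h, hT, H, hg, hJ⟩ := H
  obtain ⟨tm, htm, hmin⟩ := isCompact_Icc.exists_isMinOn (nonempty_Icc.2 hT) H.cg
  have hm := hg tm htm
  set q := h T + f T * g T
  set N := 2 + |f T| + |g T|
  have a1 := abs_nonneg (f T)
  have a2 := abs_nonneg (g T)
  have hN : 0 < N := by positivity
  obtain ⟨δ, hδ, hc⟩ := H.cd hT (min (g tm) (min 1 (q / N))) (by positivity)
  refine ⟨δ, hδ, fun c' hc' => ?_⟩
  obtain ⟨f', g', h', H', hcl⟩ := hc c' hc'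
  refine ⟨T, f', g', h', hT, H', fun t ht => ?_, ?_⟩
  · have h1 := abs_lt.1 (hcl t ht).2.1
    have h2 := min_le_left (g tm) (min 1 (q / N))
    have h3 : g tm ≤ g t := hmin ht
    linarith
  · obtain ⟨h1, h2, h3⟩ := hcl T ⟨hT, le_rfl⟩
    set ε := (min (g tm) (min 1 (q / N)))
    have e1 : ε ≤ 1 := (min_le_right _ _).trans (min_le_left _ _)
    have e2 : ε ≤ q / N := (min_le_right _ _).trans (min_le_right _ _)
    rw [le_div_iff₀ hN] at e2
    have e0 : 0 < ε := by simp only [ε]; positivity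
    have : |h' T + f' T * g' T - q| < ε * N := by
      have e : h' T + f' T * g' T - q = (h' T - h T) + ((f' T - f T) * (g' T - g T) +
        (f' T - f T) * g T + f T * (g' T - g T)) := by simp only [q]; ring
      rw [e]
      have b1 : |(f' T - f T) * (g' T - g T)| ≤ ε * 1 := by
        rw [abs_mul]; gcongr; linarith
      have b2 : |(f' T - f T) * g T| ≤ ε * |g T| := by
        rw [abs_mul]; gcongr
      have b3 : |f T * (g' T - g T)| ≤ |f T| * ε := by
        rw [abs_mul]; gcongr
      have t1 := abs_add_le (h' T - h T) ((f' T - f T) * (g' T - g T) +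
        (f' T - f T) * g T + f T * (g' T - g T))
      have t2 := abs_add_le ((f' T - f T) * (g' T - g T) + (f' T - f T) * g T) (f T * (g' T - g T))
      have t3 := abs_add_le ((f' T - f T) * (g' T - g T)) ((f' T - f T) * g T)
      simp only [N]
      nlinarith
    have := (abs_lt.1 this).1
    linarith

lemma EE.not_DD {β a b c : ℝ} (hβ1 : 0 < β) (hβ2 : β ≤ 1) (hb : 1 ≤ b) (H : EE β a b c) :
    ¬ DD β a b c := by
  rintro ⟨T', f', g', h', hT', H', hg'⟩
  obtain ⟨T, f, g, h, hT, H, hg, hJ⟩ := H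
  have hTT : T < T' := by
    by_contra! hle
    have := ((H.mono hle).unique H') T' ⟨hT', le_rfl⟩
    have := hg T' ⟨hT', hle⟩
    linarith
  have ag := H.unique (H'.mono hTT.le)
  obtain ⟨e1, e2, e3⟩ := ag T ⟨hT, le_rfl⟩
  obtain ⟨t1, ht1, e, hp⟩ := first_zero H'.cg hT' (by rw [H'.g0]; linarith) hg'.le
  have hT1 : T < t1 := by
    by_contra! hle
    have h1 := hg t1 ⟨ht1.1.le, hle⟩
    have h2 := (ag t1 ⟨ht1.1.le, hle⟩).2.1
    linarith
  have hnn : ∀ s ∈ Icc 0 t1, 0 ≤ g' s := fun s hs => by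
    rcases hs.2.lt_or_eq with h | h
    · exact (hp s ⟨hs.1, h⟩).le
    · rw [h, e]
  have hm := (H'.mono ht1.2).J_mono hβ1 hβ2 hnn ⟨hT, hT1.le⟩ ⟨ht1.1.le, le_rfl⟩ hT1.le
  simp only [e, ← e1, ← e2, ← e3] at hm
  have hpos : 0 < h' t1 := by linarith
  -- derivative positive at t1 contradicts g' > 0 before
  have hd := (H'.dg t1 ⟨ht1.1.le, ht1.2⟩)
  have hch : ContinuousAt h' t1 := (H'.dh t1 ⟨ht1.1.le, ht1.2⟩).continuousAt
  obtain ⟨η, hη, hη'⟩ := Metric.eventually_nhds_iff.1 (hch.eventually (lt_mem_nhds hpos))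
  set s := max (t1 - η / 2) T
  have hs1 : s < t1 := max_lt (by linarith) hT1
  have hs0 : 0 ≤ s := hT.trans (le_max_right _ _)
  have := smono_of (x := g') (x' := h') (s := s) (T := t1)
    (H'.cg.mono (Icc_subset_Icc hs0 ht1.2))
    (fun u hu => H'.dg u ⟨hs0.trans hu.1.le, hu.2.le.trans ht1.2⟩)
    (fun u hu => hη' (by
      have := le_max_left (t1 - η / 2) T
      rw [Real.dist_eq, abs_lt]; constructor <;> linarith [hu.1, hu.2]))
    ⟨le_rfl, hs1.le⟩ ⟨hs1.le, le_rfl⟩ hs1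
  have := hp s ⟨hs0, hs1⟩
  linarith

lemma DD_exists {β a b : ℝ} (hβ1 : 0 < β) (hβ2 : β ≤ 1) (ha : 0 ≤ a) (hb : 1 ≤ b) :
    DD β a b (-(a * b + b^2 + b + 1)) := by
  by_contra hD
  obtain ⟨F, hF, hpos⟩ := global_of_not_DD hβ1 hβ2 ha hb hD
  set c := -(a * b + b^2 + b + 1) with hc
  have H := hF.fs 1
  set g := deriv F
  set h := deriv g
  have hnn : ∀ t ∈ Icc (0:ℝ) 1, 0 ≤ g t := fun t ht => (hpos t ht.1).le
  have bound : ∀ T ∈ Icc (0:ℝ) 1, (∀ t ∈ Ico 0 T, h t < 0) → ∀ t ∈ Icc 0 T, h t ≤ -(b + 1) := by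
    intro T hT hneg t ht
    have sub : Icc 0 T ⊆ Icc (0:ℝ) 1 := Icc_subset_Icc le_rfl hT.2
    have ga : ∀ s ∈ Icc 0 T, g s ≤ b := fun s hs => by
      have := anti_of (H.cg.mono sub) (fun u hu => H.dg u (sub (Ioo_subset_Icc_self hu)))
        (fun u hu => (hneg u ⟨hu.1.le, hu.2⟩).le) ⟨le_rfl, hT.1⟩ hs hs.1
      rwa [H.g0] at this
    have := anti_of (x := fun t => h t + F t * g t - b^2 * t)
      (((H.ch.add (H.cf.mul H.cg)).mono sub).sub (by fun_prop))
      (fun u hu => (H.dJ u (sub (Ioo_subset_Icc_self hu))).sub ((hasDerivAt_id u).const_mul _))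
      (fun u hu => by
        have h1 := hnn u (sub (Ioo_subset_Icc_self hu))
        have h2 := ga u (Ioo_subset_Icc_self hu)
        have h3 : g u ^ 2 ≤ b ^ 2 := by gcongr
        have h4 : g u ≤ b ^ 2 := by nlinarith
        nlinarith) ⟨le_rfl, hT.1⟩ ht ht.1
    simp only [H.f0, H.g0, H.h0] at this
    have h5 := H.f_ge hnn t (sub ht)
    have h6 : 0 ≤ F t * g t := mul_nonneg (by linarith) (hnn t (sub ht))
    have h7 := (sub ht).2
    have h8 : b^2 * t ≤ b^2 * 1 := by gcongr
    rw [hc] at this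
    linarith
  have hneg : ∀ t ∈ Icc (0:ℝ) 1, h t < 0 := by
    intro t ht
    by_contra! hn
    obtain ⟨t1, ht1, e, hp⟩ := first_zero (g := fun t => - h t)
      ((H.ch.mono (Icc_subset_Icc le_rfl ht.2)).neg) ht.1
      (by rw [H.h0, hc]; nlinarith [mul_nonneg ha (by linarith : 0 ≤ b)]) (by linarith)
    have := bound t1 ⟨ht1.1.le, ht1.2.trans ht.2⟩ (fun s hs => by linarith [hp s hs]) t1
      ⟨ht1.1.le, le_rfl⟩
    linarith
  have hb' := bound 1 ⟨by norm_num, le_rfl⟩ (fun t ht => hneg t (Ico_subset_Icc_self ht))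
  have := anti_of (x := fun t => g t + (b + 1) * t) (H.cg.add (by fun_prop))
    (fun u hu => (H.dg u (Ioo_subset_Icc_self hu)).add ((hasDerivAt_id u).const_mul _))
    (fun u hu => by linarith [hb' u (Ioo_subset_Icc_self hu)]) ⟨le_rfl, by norm_num⟩
    ⟨by norm_num, le_rfl⟩ (by norm_num : (0:ℝ) ≤ 1)
  simp only [H.g0] at this
  linarith [hpos 1 (by norm_num)]


lemma blow {β t₂ : ℝ} {f g h : ℝ → ℝ} (hβ : 0 < β)
    (df : ∀ t ≥ t₂, HasDerivAt f (g t) t) (dg : ∀ t ≥ t₂, HasDerivAt g (h t) t)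
    (dh : ∀ t ≥ t₂, HasDerivAt h (-(f t * h t) - β * g t * (g t - 1)) t)
    (hg : g t₂ < 0) (hh : h t₂ < 0) : False := by
  have cf : ContinuousOn f (Ici t₂) := fun t ht => (df t ht).continuousAt.continuousWithinAt
  have cg : ContinuousOn g (Ici t₂) := fun t ht => (dg t ht).continuousAt.continuousWithinAt
  have ch : ContinuousOn h (Ici t₂) := fun t ht => (dh t ht).continuousAt.continuousWithinAt
  have hneg : ∀ t ≥ t₂, h t < 0 := by
    intro t ht
    by_contra! hn
    obtain ⟨t1, ht1, e, hp⟩ := first_zero (g := fun t => - h t) (s := t₂) (T := t)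
      (ch.mono Icc_subset_Ici_self).neg ht (by linarith) (by linarith)
    have ga := anti_of (s := t₂) (T := t1) (cg.mono Icc_subset_Ici_self)
      (fun u hu => dg u hu.1.le) (fun u hu => by linarith [hp u ⟨hu.1.le, hu.2⟩])
    have := scal_pos (x := fun t => - h t) (p := fun t => - f t) (s := t₂) (T := t1)
      (ch.mono Icc_subset_Ici_self).neg (cf.mono Icc_subset_Ici_self).neg
      (fun u hu => (dh u hu.1.le).neg) (fun u hu => by
        have := ga ⟨le_rfl, ht1.1.le⟩ ⟨hu.1.le, hu.2.le⟩ hu.1.le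
        have : 0 ≤ β * (g u * (g u - 1)) := mul_nonneg hβ.le (by nlinarith)
        nlinarith) (by linarith) t1 ⟨ht1.1.le, le_rfl⟩
    linarith
  set δ := - g t₂ with hδ
  have δ0 : 0 < δ := by linarith
  have gle : ∀ t ≥ t₂, g t ≤ -δ := by
    intro t ht
    have := lin_dec (δ := 0) dg (fun t ht => by linarith [hneg t ht]) t ht
    linarith
  have fle := lin_dec df gle
  set t4 := t₂ + |f t₂| / δ with ht4
  have q0 : 0 ≤ |f t₂| / δ := by positivity
  have f4 : ∀ t ≥ t4, f t ≤ 0 := by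
    intro t ht
    have h1 := fle t (by linarith)
    have h2 : |f t₂| / δ ≤ t - t₂ := by linarith
    rw [div_le_iff₀ δ0] at h2
    linarith [le_abs_self (f t₂)]
  set k0 := - h t4 with hk0
  have k0p : 0 < k0 := by linarith [hneg t4 (by linarith)]
  have hle : ∀ t ≥ t4, h t ≤ -k0 := by
    intro t ht
    have := lin_dec (g := h) (T₀ := t4) (δ := 0) (fun t ht => dh t (by linarith)) (fun t ht => by
      have h1 := f4 t ht
      have h2 := hneg t (by linarith)
      have h3 := gle t (by linarith)
      have : 0 ≤ β * (g t * (g t - 1)) := mul_nonneg hβ.le (by nlinarith)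
      nlinarith) t ht
    linarith
  have glin := lin_dec (T₀ := t4) (fun t ht => dg t (by linarith)) hle
  have hE := lin_dec (g := fun t => -(h t ^ 2 + 2 * β / 3 * g t ^ 3)) (T₀ := t4) (δ := 0)
    (fun t ht => (((dh t (by linarith)).pow 2).add (((dg t (by linarith)).pow 3).const_mul _)).neg)
    (fun t ht => by
      have h1 := f4 t ht
      have h2 := hneg t (by linarith)
      have h3 := gle t (by linarith)
      have h4 : 0 ≤ (f t * h t) * (- h t) := mul_nonneg (by nlinarith) (by linarith)
      have h5 : 0 ≤ (β * (-g t)) * (- h t) := mul_nonneg (mul_nonneg hβ.le (by linarith)) (by linarith)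
      norm_num
      nlinarith)
  set E4 := h t4 ^ 2 + 2 * β / 3 * g t4 ^ 3 with hE4
  set M := 1 + 3 * |E4| / β with hM
  have M1 : 0 ≤ 3 * |E4| / β := by positivity
  set t5 := t4 + M / k0 with ht5
  have q5 : 0 ≤ M / k0 := by positivity
  have key : ∀ t ≥ t5, M ≤ - g t ∧ β / 3 * (- g t)^3 ≤ (- h t)^2 := by
    intro t ht
    have h1 := glin t (by linarith)
    have h2 : M / k0 ≤ t - t4 := by linarith
    rw [div_le_iff₀ k0p] at h2
    have h3 := gle t4 (by linarith)
    have h4 : M ≤ - g t := by linarith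
    refine ⟨h4, ?_⟩
    have h5 := hE t (by linarith)
    have h6 : 3 * |E4| / β ≤ - g t := by linarith
    rw [div_le_iff₀ hβ] at h6
    set w := - g t with hw
    have w1 : 1 ≤ w := by linarith
    have w3 : w ≤ w^3 := by nlinarith [sq_nonneg w]
    have : g t ^ 3 = - w^3 := by rw [hw]; ring
    rw [this] at h5
    have h7 := neg_abs_le E4
    have h8 := mul_le_mul_of_nonneg_left w3 hβ.le
    nlinarith
  have t25 : t₂ ≤ t5 := by linarith
  have dw : ∀ t ≥ t5, HasDerivAt (fun t => (√(- g t))⁻¹)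
      (-(- h t / (2 * √(- g t))) / √(- g t) ^ 2) t := by
    intro t ht
    have h1 : 0 < - g t := by
      have := gle t (by linarith)
      linarith
    have d1 : HasDerivAt (fun t => - g t) (- h t) t := (dg t (by linarith)).neg
    exact (d1.sqrt h1.ne').inv (Real.sqrt_pos.2 h1).ne'
  refine no_lin_dec (T₀ := t5) (δ := √(β / 3) / 2) (B := 0)
    (by positivity) dw (fun t ht => ?_) (fun t ht => ?_)
  · obtain ⟨h1, h2⟩ := key t ht
    have w0 : 0 < - g t := by linarith
    have h3 := hneg t (by linarith)
    set w := - g t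
    set r := √w
    have r0 : 0 < r := Real.sqrt_pos.2 w0
    have hr : r^2 = w := Real.sq_sqrt w0.le
    have hs : √(β/3)^2 = β/3 := Real.sq_sqrt (by positivity)
    have : √(β/3) * r^3 ≤ - h t := by
      apply le_of_sq_le_sq _ (by linarith)
      calc (√(β/3) * r^3)^2 = √(β/3)^2 * (r^2)^3 := by ring
        _ ≤ _ := by rw [hs, hr]; exact h2
    rw [neg_div, neg_le_neg_iff, div_div, le_div_iff₀ (by positivity)]
    calc √(β/3) / 2 * (2 * r * r^2) = √(β/3) * r^3 := by ring
      _ ≤ _ := this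
  · have := gle t (by linarith)
    have := Real.sqrt_pos.2 (show 0 < - g t by linarith)
    positivity

lemma DD.no_sol {β a b c : ℝ} (hβ : 0 < β) (hb : 1 ≤ b) (H : DD β a b c) :
    ¬ ∃ F, IsSolWithParam β a b c F := by
  rintro ⟨F, hF⟩
  obtain ⟨T, f', g', h', hT, H', hg⟩ := H
  have hun := (H'.unique (hF.fs T) T ⟨hT, le_rfl⟩).2.1
  rw [hun] at hg
  have H := hF.fs T
  have cr : ContinuousOn (fun s => - deriv F (T - s)) (Icc 0 T) :=
    (H.cg.comp (by fun_prop) (fun s hs => ⟨by linarith [hs.2], by linarith [hs.1]⟩)).neg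
  obtain ⟨s1, hs1, e, hp⟩ := first_zero cr hT (by simpa using hg) (by simp [H.g0]; linarith)
  obtain ⟨t2, ht2, hd⟩ := exists_hasDerivAt_eq_slope (deriv F) (deriv (deriv F))
    (show T - s1 < T by linarith [hs1.1])
    (H.cg.mono (Icc_subset_Icc (by linarith [hs1.2]) le_rfl))
    (fun x hx => H.dg x ⟨by linarith [hs1.2, hx.1], hx.2.le⟩)
  have g2 := hp (T - t2) ⟨by linarith [ht2.2], by linarith [ht2.1]⟩
  simp only [sub_sub_cancel] at g2
  have t0 : 0 ≤ t2 := by linarith [hs1.2, ht2.1]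
  have h2 : deriv (deriv F) t2 < 0 := by
    rw [hd]
    apply div_neg_of_neg_of_pos <;> linarith [hs1.1]
  exact blow (t₂ := t2) hβ (fun t ht => (hF.fs t).df t ⟨by linarith, le_rfl⟩)
    (fun t ht => (hF.fs t).dg t ⟨by linarith, le_rfl⟩)
    (fun t ht => (hF.fs t).dh t ⟨by linarith, le_rfl⟩) (by linarith) h2

lemma FS.phase {β a b c T : ℝ} {f g h : ℝ → ℝ} (hT : 0 ≤ T)
    (H : FS β a b c T f g h) (hn : ∀ t ∈ Icc 0 T, h t < 0) :
    ∃ φ : ℝ → ℝ, (∀ s ∈ Icc 0 (b - g T), φ s ∈ Icc 0 T ∧ g (φ s) = b - s) ∧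
      ContinuousOn φ (Icc 0 (b - g T)) ∧
      (∀ s ∈ Ioo 0 (b - g T), HasDerivAt φ (- h (φ s))⁻¹ s) ∧
      (∀ t ∈ Icc 0 T, b - g t ∈ Icc 0 (b - g T) ∧ φ (b - g t) = t) := by
  obtain ⟨tm, htm, hmin⟩ := isCompact_Icc.exists_isMaxOn (nonempty_Icc.2 hT) H.ch
  set m := - h tm with hm
  have m0 : 0 < m := by linarith [hn tm htm]
  have ga : AntitoneOn (fun t => g t + m * t) (Icc 0 T) :=
    anti_of (H.cg.add (by fun_prop))
      (fun t ht => (H.dg t (Ioo_subset_Icc_self ht)).add ((hasDerivAt_id t).const_mul m))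
      (fun t ht => by
        have : h t ≤ h tm := hmin (Ioo_subset_Icc_self ht)
        linarith)
  have low : ∀ t ∈ Icc 0 T, ∀ t' ∈ Icc 0 T, |t - t'| ≤ m⁻¹ * |g t - g t'| := by
    have aux : ∀ t ∈ Icc 0 T, ∀ t' ∈ Icc 0 T, t ≤ t' → |t - t'| ≤ m⁻¹ * |g t - g t'| := by
      intro t ht t' ht' hle
      have h1 := ga ht ht' hle
      simp only at h1
      rw [abs_sub_comm, abs_of_nonneg (by linarith), inv_mul_eq_div, le_div_iff₀ m0]
      have := le_abs_self (g t - g t')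
      linarith
    intro t ht t' ht'
    rcases le_total t t' with hle | hle
    · exact aux t ht t' ht' hle
    · have := aux t' ht' t ht hle
      rwa [abs_sub_comm, abs_sub_comm (g t')] at this
  have hrange : ∀ t ∈ Icc 0 T, b - g t ∈ Icc 0 (b - g T) := by
    intro t ht
    have h1 := ga ⟨le_rfl, hT⟩ ht ht.1
    have h2 := ga ht ⟨hT, le_rfl⟩ ht.2
    simp only [H.g0] at h1 h2
    have h3 : m * t ≤ m * T := mul_le_mul_of_nonneg_left ht.2 m0.le
    have h4 : 0 ≤ m * t := mul_nonneg m0.le ht.1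
    constructor <;> linarith
  have ex : ∀ s ∈ Icc 0 (b - g T), ∃ t ∈ Icc 0 T, g t = b - s := by
    intro s hs
    have := intermediate_value_Icc' hT H.cg (show b - s ∈ Icc (g T) (g 0) by
      rw [H.g0]; constructor <;> linarith [hs.1, hs.2])
    obtain ⟨t, ht, e⟩ := this
    exact ⟨t, ht, e⟩
  choose! φ hφ using ex
  have cφ : ContinuousOn φ (Icc 0 (b - g T)) := by
    have : LipschitzOnWith (Real.toNNReal m⁻¹) φ (Icc 0 (b - g T)) := by
      apply LipschitzOnWith.of_dist_le_mul
      intro s hs s' hs'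
      have := low _ (hφ s hs).1 _ (hφ s' hs').1
      rw [(hφ s hs).2, (hφ s' hs').2] at this
      rw [Real.dist_eq, Real.dist_eq, Real.coe_toNNReal _ (by positivity)]
      rw [show b - s - (b - s') = s' - s by ring, abs_sub_comm s'] at this
      exact this
    exact this.continuousOn
  refine ⟨φ, hφ, cφ, fun s hs => ?_, fun t ht => ⟨hrange t ht, ?_⟩⟩
  · have hs' := Ioo_subset_Icc_self hs
    obtain ⟨h1, h2⟩ := hφ s hs'
    have d := ((H.dg _ h1).const_sub b)
    refine HasDerivAt.of_local_left_inverse (cφ.continuousAt (Icc_mem_nhds hs.1 hs.2)) d ?_ ?_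
    · have := hn _ h1
      linarith
    · filter_upwards [Icc_mem_nhds hs.1 hs.2] with y hy
      rw [(hφ y hy).2]; ring
  · have h1 := hφ _ (hrange t ht)
    have := low _ h1.1 _ ht
    rw [h1.2] at this
    simp at this
    linarith

lemma phase_cmp {β a b c₁ c₂ T₁ T₂ : ℝ} {f₁ g₁ h₁ f₂ g₂ h₂ : ℝ → ℝ} (hβ : 0 < β) (hb : 1 ≤ b)
    (hc : c₁ < c₂) (hT₁ : 0 ≤ T₁) (hT₂ : 0 ≤ T₂)
    (H₁ : FS β a b c₁ T₁ f₁ g₁ h₁) (H₂ : FS β a b c₂ T₂ f₂ g₂ h₂)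
    (hn₁ : ∀ t ∈ Icc 0 T₁, h₁ t < 0) (hn₂ : ∀ t ∈ Icc 0 T₂, h₂ t < 0)
    (hu : g₁ T₁ = g₂ T₂) (hu0 : 0 ≤ g₁ T₁) :
    ∀ t₁ ∈ Icc 0 T₁, ∀ t₂ ∈ Icc 0 T₂, g₁ t₁ = g₂ t₂ → h₁ t₁ < h₂ t₂ ∧
      (g₁ t₁ ≤ 1 → h₂ t₂ - h₁ t₁ ≤ h₂ T₂ - h₁ T₁) := by
  obtain ⟨φ₁, e₁, cφ₁, dφ₁, i₁⟩ := H₁.phase hT₁ hn₁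
  obtain ⟨φ₂, e₂, cφ₂, dφ₂, i₂⟩ := H₂.phase hT₂ hn₂
  rw [← hu] at e₂ cφ₂ dφ₂ i₂
  set S := b - g₁ T₁ with hS
  have S0 : 0 ≤ S := by
    have := (i₁ T₁ ⟨hT₁, le_rfl⟩).1.1
    linarith
  have P₁ : ContinuousOn (fun s => h₁ (φ₁ s)) (Icc 0 S) := H₁.ch.comp cφ₁ fun s hs => (e₁ s hs).1
  have P₂ : ContinuousOn (fun s => h₂ (φ₂ s)) (Icc 0 S) := H₂.ch.comp cφ₂ fun s hs => (e₂ s hs).1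
  have G₁ : ContinuousOn (fun s => f₁ (φ₁ s)) (Icc 0 S) := H₁.cf.comp cφ₁ fun s hs => (e₁ s hs).1
  have G₂ : ContinuousOn (fun s => f₂ (φ₂ s)) (Icc 0 S) := H₂.cf.comp cφ₂ fun s hs => (e₂ s hs).1
  have n₁ : ∀ s ∈ Icc 0 S, h₁ (φ₁ s) < 0 := fun s hs => hn₁ _ (e₁ s hs).1
  have n₂ : ∀ s ∈ Icc 0 S, h₂ (φ₂ s) < 0 := fun s hs => hn₂ _ (e₂ s hs).1
  have ne : ∀ s ∈ Icc 0 S, h₁ (φ₁ s) * h₂ (φ₂ s) ≠ 0 := fun s hs =>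
    (mul_pos_of_neg_of_neg (n₁ s hs) (n₂ s hs)).ne'
  have z₁ : φ₁ 0 = 0 := by
    have := (i₁ 0 ⟨le_rfl, hT₁⟩).2; rwa [H₁.g0, sub_self] at this
  have z₂ : φ₂ 0 = 0 := by
    have := (i₂ 0 ⟨le_rfl, hT₂⟩).2; rwa [H₂.g0, sub_self] at this
  have dd : ∀ s ∈ Ioo 0 S, HasDerivAt (fun s => h₂ (φ₂ s) - h₁ (φ₁ s))
      (-(β * (b - s) * (b - s - 1)) / (h₁ (φ₁ s) * h₂ (φ₂ s)) * (h₂ (φ₂ s) - h₁ (φ₁ s))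
        + (f₂ (φ₂ s) - f₁ (φ₁ s))) s := by
    intro s hs
    have hs' := Ioo_subset_Icc_self hs
    have := ((H₂.dh _ (e₂ s hs').1).comp s (dφ₂ s hs)).sub
      ((H₁.dh _ (e₁ s hs').1).comp s (dφ₁ s hs))
    refine this.congr_deriv ?_
    have q1 := (n₁ s hs').ne
    have q2 := (n₂ s hs').ne
    rw [(e₁ s hs').2, (e₂ s hs').2]
    field_simp
    ring
  have dD : ∀ s ∈ Ioo 0 S, HasDerivAt (fun s => f₂ (φ₂ s) - f₁ (φ₁ s))
      ((b - s) / (h₁ (φ₁ s) * h₂ (φ₂ s)) * (h₂ (φ₂ s) - h₁ (φ₁ s))) s := by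
    intro s hs
    have hs' := Ioo_subset_Icc_self hs
    have := ((H₂.df _ (e₂ s hs').1).comp s (dφ₂ s hs)).sub
      ((H₁.df _ (e₁ s hs').1).comp s (dφ₁ s hs))
    refine this.congr_deriv ?_
    have q1 := (n₁ s hs').ne
    have q2 := (n₂ s hs').ne
    rw [(e₁ s hs').2, (e₂ s hs').2]
    field_simp
    ring
  have cp : ContinuousOn (fun s => -(β * (b - s) * (b - s - 1)) / (h₁ (φ₁ s) * h₂ (φ₂ s)))
      (Icc 0 S) := ContinuousOn.div (by fun_prop) (P₁.mul P₂) ne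
  have cr : ContinuousOn (fun s => (b - s) / (h₁ (φ₁ s) * h₂ (φ₂ s)))
      (Icc 0 S) := ContinuousOn.div (by fun_prop) (P₁.mul P₂) ne
  have d0 : 0 < h₂ (φ₂ 0) - h₁ (φ₁ 0) := by
    rw [z₁, z₂, H₁.h0, H₂.h0]; linarith
  have cc := coop (P₂.sub P₁) (G₂.sub G₁) cp cr dd dD (fun s _ => le_rfl) (fun s _ => le_rfl)
    (fun s hs => div_nonneg (by linarith [hs.2])
      (mul_pos_of_neg_of_neg (n₁ s hs) (n₂ s hs)).le) d0.le
    (by simp only [Pi.sub_apply]; rw [z₁, z₂, H₁.f0, H₂.f0]; simp)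
  simp only [Pi.sub_apply] at cc
  have pos := scal_pos (P₂.sub P₁) cp dd (fun s hs => by
    have := (cc s (Ioo_subset_Icc_self hs)).2
    simp only [Pi.sub_apply]; linarith) d0
  simp only [Pi.sub_apply] at pos
  intro t₁ ht₁ t₂ ht₂ he
  obtain ⟨j1, j2⟩ := i₁ t₁ ht₁
  obtain ⟨j3, j4⟩ := i₂ t₂ ht₂
  rw [← he] at j4
  refine ⟨?_, fun hle => ?_⟩
  · have := pos _ j1
    rw [j2, j4] at this; linarith
  · have mm := mono_of (s := b - g₁ t₁) (T := S)
      ((P₂.sub P₁).mono (Icc_subset_Icc j1.1 le_rfl))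
      (fun s hs => dd s ⟨by linarith [hs.1, j1.1], hs.2⟩)
      (fun s hs => by
        have hs' : s ∈ Icc 0 S := ⟨by linarith [hs.1, j1.1], hs.2.le⟩
        have l1 := hs.1
        have l2 := hs.2
        have c1 := cc s hs'
        have : 0 ≤ -(β * (b - s) * (b - s - 1)) / (h₁ (φ₁ s) * h₂ (φ₂ s)) := by
          apply div_nonneg _ (mul_pos_of_neg_of_neg (n₁ s hs') (n₂ s hs')).le
          have : 0 ≤ β * (b - s) * (1 - (b - s)) :=
            mul_nonneg (mul_nonneg hβ.le (by linarith)) (by linarith)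
          linarith
        have := mul_nonneg this c1.1
        linarith) ⟨le_rfl, j1.2⟩ ⟨j1.2, le_rfl⟩ j1.2
    have k1 := (i₁ T₁ ⟨hT₁, le_rfl⟩).2
    have k2 := (i₂ T₂ ⟨hT₂, le_rfl⟩).2
    rw [← hS] at k1
    rw [← hu, ← hS] at k2
    simp only [Pi.sub_apply] at mm
    rwa [j2, j4, k1, k2] at mm

section glob
variable {β a b c : ℝ} {F : ℝ → ℝ}

lemma IsSolWithParam.d0 (hF : IsSolWithParam β a b c F) :
    ∀ t ≥ 0, HasDerivAt F (deriv F t) t := fun t ht => (hF.fs t).df t ⟨ht, le_rfl⟩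
lemma IsSolWithParam.d1 (hF : IsSolWithParam β a b c F) :
    ∀ t ≥ 0, HasDerivAt (deriv F) (deriv (deriv F) t) t := fun t ht => (hF.fs t).dg t ⟨ht, le_rfl⟩
lemma IsSolWithParam.d2 (hF : IsSolWithParam β a b c F) :
    ∀ t ≥ 0, HasDerivAt (deriv (deriv F))
      (-(F t * deriv (deriv F) t) - β * deriv F t * (deriv F t - 1)) t :=
  fun t ht => (hF.fs t).dh t ⟨ht, le_rfl⟩

lemma IsSolWithParam.f_ge (hF : IsSolWithParam β a b c F) (hp : ∀ t ≥ 0, 0 < deriv F t) :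
    ∀ t ≥ 0, a ≤ F t := fun t ht => (hF.fs t).f_ge (fun s hs => (hp s hs.1).le) t ⟨ht, le_rfl⟩

lemma IsSolWithParam.f_pos (ha : 0 ≤ a) (hF : IsSolWithParam β a b c F)
    (hp : ∀ t ≥ 0, 0 < deriv F t) : ∀ t > 0, 0 < F t := fun t ht => by
  have := smono_of (hF.fs t).cf (fun s hs => hF.d0 s hs.1.le) (fun s hs => hp s hs.1.le)
    ⟨le_rfl, ht.le⟩ ⟨ht.le, le_rfl⟩ ht
  rw [(hF.fs t).f0] at this
  linarith

lemma IsSolWithParam.not_NA (hF : IsSolWithParam β a b c F) (hN : ¬ NA β a b c) :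
    ∀ t ≥ 0, 1 ≤ deriv F t := by
  intro t ht
  by_contra! h
  exact hN ⟨t, _, _, _, ht, hF.fs t, h⟩

lemma IsSolWithParam.ofNA (hF : IsSolWithParam β a b c F) (hN : NA β a b c) :
    ∃ t ≥ 0, deriv F t < 1 := by
  obtain ⟨T, f, g, h, hT, H, hg⟩ := hN
  have := (H.unique (hF.fs T) T ⟨hT, le_rfl⟩).2.1
  exact ⟨T, hT, by linarith⟩

lemma IsSolWithParam.ofEE (hF : IsSolWithParam β a b c F) (hN : EE β a b c) :
    ∃ t ≥ 0, 0 < deriv (deriv F) t + F t * deriv F t := by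
  obtain ⟨T, f, g, h, hT, H, hg, hh⟩ := hN
  obtain ⟨h1, h2, h3⟩ := H.unique (hF.fs T) T ⟨hT, le_rfl⟩
  exact ⟨T, hT, by rwa [← h1, ← h2, ← h3]⟩

lemma IsSolWithParam.not_EE (hF : IsSolWithParam β a b c F) (hp : ∀ t ≥ 0, 0 < deriv F t)
    (hN : ¬ EE β a b c) : ∀ t ≥ 0, deriv (deriv F) t + F t * deriv F t ≤ 0 := by
  intro t ht
  by_contra! h
  exact hN ⟨t, _, _, _, ht, hF.fs t, fun s hs => hp s hs.1, h⟩

/-- a decreasing bounded below function has a limit -/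
lemma anti_lim {g h : ℝ → ℝ} {s B : ℝ} (dg : ∀ t ≥ s, HasDerivAt g (h t) t)
    (hh : ∀ t ≥ s, h t ≤ 0) (hB : ∀ t ≥ s, B ≤ g t) :
    ∃ l, Tendsto g atTop (𝓝 l) ∧ B ≤ l ∧ ∀ t ≥ s, l ≤ g t := by
  have am : ∀ t ≥ s, ∀ t' ≥ t, g t' ≤ g t := by
    intro t ht t' ht'
    have := lin_dec (T₀ := t) (δ := 0) (fun u hu => dg u (by linarith [hu.le]))
      (fun u hu => by linarith [hh u (by linarith [hu.le])]) t' ht'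
    linarith
  have bd : BddBelow (g '' Ici s) := ⟨B, by rintro _ ⟨t, ht, rfl⟩; exact hB t ht⟩
  have nz : (g '' Ici s).Nonempty := ⟨_, s, self_mem_Ici, rfl⟩
  refine ⟨sInf (g '' Ici s), ?_, le_csInf nz (by rintro _ ⟨t, ht, rfl⟩; exact hB t ht),
    fun t ht => csInf_le bd ⟨t, ht, rfl⟩⟩
  rw [Metric.tendsto_atTop]
  intro ε hε
  obtain ⟨_, ⟨t, ht, rfl⟩, hlt⟩ := exists_lt_of_csInf_lt nz
    (show sInf (g '' Ici s) < sInf (g '' Ici s) + ε by linarith)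
  refine ⟨t, fun u hu => ?_⟩
  have h1 := am t ht u hu
  have h2 : sInf (g '' Ici s) ≤ g u := csInf_le bd ⟨u, le_trans ht hu, rfl⟩
  rw [Real.dist_eq, abs_lt]; constructor <;> linarith

lemma not_NA.EE (hβ1 : 0 < β) (hβ2 : β ≤ 1) (ha : 0 ≤ a) (hb : 1 ≤ b) (hN : ¬ NA β a b c) :
    EE β a b c := by
  by_contra hE
  obtain ⟨F, hF, hp⟩ := global_of_not_DD hβ1 hβ2 ha hb (fun h => hN h.na)
  have h1 := hF.not_NA hN
  have h2 := hF.not_EE hp hE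
  refine no_lin_dec (g := fun t => -(deriv (deriv F) t + F t * deriv F t)) (T₀ := 0) (δ := 1)
    (B := -1) one_pos (fun t ht => ((hF.fs t).dJ t ⟨ht, le_rfl⟩).neg) (fun t ht => ?_)
    (fun t ht => by linarith [h2 t ht])
  have := h1 t ht
  have : 0 ≤ (1 - β) * (deriv F t ^ 2 - 1) := mul_nonneg (by linarith) (by nlinarith)
  nlinarith

/-- along a non-escaping solution `f'' < 0` -/
lemma not_EE_neg (ha : 0 ≤ a) (hb : 1 ≤ b) (hc : c < 0)
    (hF : IsSolWithParam β a b c F) (hp : ∀ t ≥ 0, 0 < deriv F t) (hE : ¬ EE β a b c) :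
    (∀ t ≥ 0, deriv (deriv F) t < 0) ∧ Tendsto (deriv F) atTop (𝓝 0) := by
  have hJ := hF.not_EE hp hE
  have fp := hF.f_pos ha hp
  have hn : ∀ t ≥ 0, deriv (deriv F) t < 0 := by
    intro t ht
    rcases ht.lt_or_eq with h | h
    · have := mul_pos (fp t h) (hp t ht)
      linarith [hJ t ht]
    · rw [← h, (hF.fs 0).h0]; exact hc
  refine ⟨hn, ?_⟩
  obtain ⟨l, hl, l0, hle⟩ := anti_lim hF.d1 (fun t ht => (hn t ht).le) (fun t ht => (hp t ht).le)
  rcases l0.lt_or_eq with h | h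
  · exfalso
    refine no_lin_dec (g := deriv F) (T₀ := 1) (δ := F 1 * l) (B := 0)
      (mul_pos (fp 1 one_pos) h) (fun t ht => hF.d1 t (by linarith)) (fun t ht => ?_)
      (fun t ht => hp t (by linarith))
    have h1 := hJ t (by linarith)
    have h2 := hle t (by linarith)
    have h3 : F 1 ≤ F t := (hF.fs t).f_mono (fun s hs => (hp s hs.1).le)
      ⟨zero_le_one, ht⟩ ⟨by linarith, le_rfl⟩ ht
    have := fp 1 one_pos
    have : F 1 * l ≤ F t * deriv F t := mul_le_mul h3 h2 h.le (by linarith)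
    linarith
  · rwa [h]

/-- reach any level -/
lemma not_EE_reach (hβ1 : 0 < β) (hβ2 : β ≤ 1) (ha : 0 ≤ a) (hb : 1 ≤ b) (hc : c < 0)
    (hE : ¬ EE β a b c) {u : ℝ} (hu : 0 < u) (hub : u ≤ b) :
    ∃ T f g h, 0 ≤ T ∧ FS β a b c T f g h ∧ (∀ t ∈ Icc 0 T, h t < 0) ∧ g T = u := by
  by_cases hD : DD β a b c
  · obtain ⟨T, f, g, h, hT, H, hg⟩ := hD
    obtain ⟨t1, ht1, e, hp⟩ := first_zero H.cg hT (by rw [H.g0]; linarith) hg.le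
    have H1 := H.mono ht1.2
    obtain ⟨T', hT', e'⟩ := intermediate_value_Icc' ht1.1.le H1.cg (show u ∈ Icc (g t1) (g 0) by
      rw [H.g0, e]; exact ⟨hu.le, hub⟩)
    have hlt : T' < t1 := by
      rcases hT'.2.lt_or_eq with h | h
      · exact h
      · rw [h, e] at e'; linarith
    refine ⟨T', f, g, h, hT'.1, H1.mono hT'.2, fun t ht => ?_, e'⟩
    have H2 := H1.mono (ht.2.trans hT'.2)
    have gp : ∀ s ∈ Icc 0 t, 0 < g s := fun s hs => hp s ⟨hs.1, by linarith [hs.2, ht.2]⟩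
    rcases ht.1.lt_or_eq with h' | h'
    · have hJ : h t + f t * g t ≤ 0 := by
        by_contra! hcon
        exact hE ⟨t, f, g, h, ht.1, H2, gp, hcon⟩
      have fm := smono_of H2.cf (fun s hs => H2.df s (Ioo_subset_Icc_self hs))
        (fun s hs => gp s (Ioo_subset_Icc_self hs)) ⟨le_rfl, ht.1⟩ ⟨ht.1, le_rfl⟩ h'
      rw [H2.f0] at fm
      have := mul_pos (show 0 < f t by linarith) (gp t ⟨ht.1, le_rfl⟩)
      linarith
    · rw [← h', H.h0]; exact hc
  · obtain ⟨F, hF, hp⟩ := global_of_not_DD hβ1 hβ2 ha hb hD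
    obtain ⟨hn, hl⟩ := not_EE_neg ha hb hc hF hp hE
    obtain ⟨N, hN, hN0⟩ := ((hl.eventually (gt_mem_nhds hu)).and (eventually_ge_atTop 0)).exists
    obtain ⟨T', hT', e'⟩ := intermediate_value_Icc' hN0 (hF.fs N).cg
      (show u ∈ Icc (deriv F N) (deriv F 0) by rw [(hF.fs 0).g0]; exact ⟨hN.le, hub⟩)
    exact ⟨T', _, _, _, hT'.1, hF.fs T', fun t ht => hn t ht.1, e'⟩

end glob

/-- uniform bound: if the `c₂` orbit reaches level `u` with `f'' < 0`, a lower orbit has `f'' ≤ -m`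
above the level `u` -/
lemma low_bound {β a b c₁ c₂ T₂ u : ℝ} {F f₂ g₂ h₂ : ℝ → ℝ} (hβ1 : 0 < β) (hb : 1 ≤ b)
    (hc : c₁ < c₂) (hF : IsSolWithParam β a b c₁ F) (hT₂ : 0 ≤ T₂)
    (H₂ : FS β a b c₂ T₂ f₂ g₂ h₂) (hn₂ : ∀ t ∈ Icc 0 T₂, h₂ t < 0) (hu : g₂ T₂ = u)
    (hu0 : 0 ≤ u) :
    ∃ m > 0, ∀ t ≥ 0, (∀ s ∈ Icc 0 t, u ≤ deriv F s) →
      (∀ s ∈ Icc 0 t, deriv (deriv F) s ≤ -m) := by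
  obtain ⟨tm, htm, hmax⟩ := isCompact_Icc.exists_isMaxOn (nonempty_Icc.2 hT₂) H₂.ch
  refine ⟨- h₂ tm, by linarith [hn₂ tm htm], fun t ht hut => ?_⟩
  simp only [neg_neg]
  -- as long as `f'' < 0`
  have key : ∀ s ∈ Icc 0 t, (∀ r ∈ Icc 0 s, deriv (deriv F) r < 0) →
      deriv (deriv F) s < h₂ tm := by
    intro s hs hneg
    have ga := anti_of (hF.fs s).cg (fun r hr => hF.d1 r hr.1.le)
      (fun r hr => (hneg r (Ioo_subset_Icc_self hr)).le) ⟨le_rfl, hs.1⟩ ⟨hs.1, le_rfl⟩ hs.1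
    obtain ⟨τ, hτ, e⟩ := intermediate_value_Icc' hT₂ H₂.cg
      (show deriv F s ∈ Icc (g₂ T₂) (g₂ 0) by
        rw [hu, H₂.g0, ← (hF.fs 0).g0]; exact ⟨hut s hs, ga⟩)
    have hsub : Icc 0 τ ⊆ Icc 0 T₂ := Icc_subset_Icc le_rfl hτ.2
    have := (phase_cmp hβ1 hb hc hs.1 hτ.1 (hF.fs s) (H₂.mono hτ.2) hneg
      (fun r hr => hn₂ r (hsub hr)) e.symm (hu0.trans (hut s hs)) s ⟨hs.1, le_rfl⟩ τ
      ⟨hτ.1, le_rfl⟩ e.symm).1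
    have h2 : h₂ τ ≤ h₂ tm := hmax hτ
    linarith
  have hneg : ∀ s ∈ Icc 0 t, deriv (deriv F) s < 0 := by
    intro s hs
    by_contra! hcon
    obtain ⟨t1, ht1, e, hp⟩ := first_zero (g := fun t => h₂ tm - deriv (deriv F) t) (s := 0) (T := s)
      (continuousOn_const.sub (hF.fs s).ch) hs.1
      (by
        have : h₂ 0 ≤ h₂ tm := hmax ⟨le_rfl, hT₂⟩
        rw [H₂.h0] at this
        rw [(hF.fs 0).h0]; linarith) (by linarith [hn₂ tm htm])
    have := key t1 ⟨ht1.1.le, ht1.2.trans hs.2⟩ (fun r hr => by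
      have q := hn₂ tm htm
      rcases hr.2.lt_or_eq with h | h
      · linarith [hp r ⟨hr.1, h⟩]
      · rw [h]; linarith)
    linarith
  intro s hs
  exact (key s hs fun r hr => hneg r ⟨hr.1, hr.2.trans hs.2⟩).le

lemma FS.time_eq {β a b c T T' : ℝ} {f g h f' g' h' : ℝ → ℝ} (hT : 0 ≤ T)
    (H : FS β a b c T f g h) (H' : FS β a b c T' f' g' h')
    (hn : ∀ t ∈ Icc 0 T', h' t < 0) (e : g T = g' T') : T' ≤ T := by
  by_contra! hlt
  have h1 := (H.unique (H'.mono hlt.le) T ⟨hT, le_rfl⟩).2.1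
  have h2 := santi_of H'.cg (fun s hs => H'.dg s (Ioo_subset_Icc_self hs))
    (fun s hs => hn s (Ioo_subset_Icc_self hs)) ⟨hT, hlt.le⟩ ⟨hT.trans hlt.le, le_rfl⟩ hlt
  linarith

lemma DD_below {β a b c₁ c₂ : ℝ} (hβ1 : 0 < β) (hβ2 : β ≤ 1) (ha : 0 ≤ a) (hb : 1 ≤ b)
    (hc : c₁ < c₂) (hc2 : c₂ < 0) (hE : ¬ EE β a b c₂) : DD β a b c₁ := by
  by_contra hD
  obtain ⟨F, hF, hp⟩ := global_of_not_DD hβ1 hβ2 ha hb hD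
  have hneg : ∀ t ≥ 0, deriv (deriv F) t < 0 := by
    intro t ht
    obtain ⟨tm, htm, hmin⟩ := isCompact_Icc.exists_isMinOn (nonempty_Icc.2 ht) (hF.fs t).cg
    have h0 : deriv F tm ≤ deriv F 0 := hmin ⟨le_rfl, ht⟩
    rw [(hF.fs 0).g0] at h0
    obtain ⟨T, f, g, h, hT, H, hn, e⟩ := not_EE_reach hβ1 hβ2 ha hb hc2 hE (hp tm htm.1) h0
    obtain ⟨m, m0, hm⟩ := low_bound hβ1 hb hc hF hT H hn e (hp tm htm.1).le
    linarith [hm t ht (fun s hs => hmin hs) t ⟨ht, le_rfl⟩]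
  obtain ⟨T, f, g, h, hT, H, hn, e⟩ := not_EE_reach hβ1 hβ2 ha hb hc2 hE one_pos hb
  by_cases hg1 : ∀ t ≥ 0, 1 ≤ deriv F t
  · obtain ⟨m, m0, hm⟩ := low_bound hβ1 hb hc hF hT H hn e zero_le_one
    exact no_lin_dec m0 hF.d1 (fun t ht => hm t ht (fun s hs => hg1 s hs.1) t ⟨ht, le_rfl⟩) hp
  · push Not at hg1
    obtain ⟨t1, ht1, hlt⟩ := hg1
    obtain ⟨s0, hs0, es⟩ := intermediate_value_Icc' ht1 (hF.fs t1).cg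
      (show 1 ∈ Icc (deriv F t1) (deriv F 0) by rw [(hF.fs 0).g0]; exact ⟨hlt.le, hb⟩)
    have dpos := (phase_cmp hβ1 hb hc hs0.1 hT (hF.fs s0) H (fun r hr => hneg r hr.1) hn
      (by rw [es, e]) (by rw [es]; exact zero_le_one) s0 ⟨hs0.1, le_rfl⟩ T ⟨hT, le_rfl⟩
      (by rw [es, e])).1
    refine no_lin_dec (T₀ := s0) (δ := h T - deriv (deriv F) s0) (B := 0) (by linarith)
      (fun t ht => hF.d1 t (hs0.1.trans ht)) (fun t ht => ?_) (fun t ht => hp t (hs0.1.trans ht))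
    have t0 : 0 ≤ t := hs0.1.trans ht
    have hle : deriv F t ≤ 1 := by
      rw [← es]
      have := lin_dec (T₀ := s0) (δ := 0) (fun t ht => hF.d1 t (hs0.1.trans ht))
        (fun t ht => by linarith [hneg t (hs0.1.trans ht)]) t ht
      linarith
    obtain ⟨T', f', g', h', hT', H', hn', e'⟩ :=
      not_EE_reach hβ1 hβ2 ha hb hc2 hE (hp t t0) (hle.trans hb)
    obtain ⟨τ, hτ, eτ⟩ := intermediate_value_Icc' hT' H'.cg
      (show 1 ∈ Icc (g' T') (g' 0) by rw [e', H'.g0]; exact ⟨hle, hb⟩)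
    have hτn : ∀ r ∈ Icc 0 τ, h' r < 0 := fun r hr => hn' r ⟨hr.1, hr.2.trans hτ.2⟩
    have q1 : τ ≤ T := FS.time_eq hT H (H'.mono hτ.2) hτn (by rw [e, eτ])
    have q2 : T ≤ τ := FS.time_eq hτ.1 (H'.mono hτ.2) H hn (by rw [e, eτ])
    have q3 : T = τ := le_antisymm q2 q1
    subst q3
    have q4 := (H.unique (H'.mono hτ.2) T ⟨hT, le_rfl⟩).2.2
    have := (phase_cmp hβ1 hb hc t0 hT' (hF.fs t) H' (fun r hr => hneg r hr.1) hn'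
      e'.symm (hp t t0).le s0 ⟨hs0.1, ht⟩ T hτ (by rw [es, eτ])).2 (by rw [es])
    have := hn' T' ⟨hT', le_rfl⟩
    linarith

lemma NA_below {β a b c₁ c₂ : ℝ} (hβ1 : 0 < β) (hβ2 : β ≤ 1) (ha : 0 ≤ a) (hb : 1 ≤ b)
    (hc : c₁ < c₂) (hN : NA β a b c₂) : NA β a b c₁ := by
  by_contra hA
  obtain ⟨F, hF, hp⟩ := global_of_not_DD hβ1 hβ2 ha hb (fun h => hA h.na)
  have hg := hF.not_NA hA
  have hc2 : c₂ < 0 := by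
    have := hN.lt hβ2 hb
    have := mul_nonneg ha (sub_nonneg.2 hb)
    linarith
  obtain ⟨T, f, g, h, hT, H, hn, e⟩ : ∃ T f g h, 0 ≤ T ∧ FS β a b c₂ T f g h ∧
      (∀ t ∈ Icc 0 T, h t < 0) ∧ g T = 1 := by
    obtain ⟨T, f, g, h, hT, H, hlt⟩ := hN
    rcases hb.lt_or_eq with hb' | hb'
    · obtain ⟨t1, ht1, e, hpos⟩ := first_zero (g := fun t => g t - 1) (H.cg.sub continuousOn_const)
        hT (by rw [H.g0]; linarith) (by linarith)
      have H1 := H.mono ht1.2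
      refine ⟨t1, f, g, h, ht1.1.le, H1, fun t ht => ?_, by linarith⟩
      have := scal_pos (x := fun t => - h t) (p := fun t => - f t) H1.ch.neg H1.cf.neg
        (fun u hu => (H1.dh u (Ioo_subset_Icc_self hu)).neg) (fun u hu => by
          have := hpos u ⟨hu.1.le, hu.2⟩
          have : 0 ≤ β * (g u * (g u - 1)) := mul_nonneg hβ1.le (by nlinarith)
          nlinarith) (by rw [H.h0]; linarith) t ht
      linarith
    · refine ⟨0, f, g, h, le_rfl, H.mono hT, fun t ht => ?_, by rw [H.g0, hb']⟩
      rw [le_antisymm ht.2 ht.1, H.h0]; exact hc2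
  obtain ⟨m, m0, hm⟩ := low_bound hβ1 hb hc hF hT H hn e zero_le_one
  exact no_lin_dec m0 hF.d1 (fun t ht => hm t ht (fun s hs => hg s hs.1) t ⟨ht, le_rfl⟩) hp

section final
variable {β a b c : ℝ} {F : ℝ → ℝ}

lemma IsSolWithParam.c0 (hF : IsSolWithParam β a b c F) {s T : ℝ} (hs : 0 ≤ s) :
    ContinuousOn F (Icc s T) := (hF.fs T).cf.mono (Icc_subset_Icc hs le_rfl)
lemma IsSolWithParam.c1 (hF : IsSolWithParam β a b c F) {s T : ℝ} (hs : 0 ≤ s) :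
    ContinuousOn (deriv F) (Icc s T) := (hF.fs T).cg.mono (Icc_subset_Icc hs le_rfl)
lemma IsSolWithParam.c2 (hF : IsSolWithParam β a b c F) {s T : ℝ} (hs : 0 ≤ s) :
    ContinuousOn (deriv (deriv F)) (Icc s T) := (hF.fs T).ch.mono (Icc_subset_Icc hs le_rfl)

lemma neg_prop (hβ1 : 0 < β) (hF : IsSolWithParam β a b c F) {s T : ℝ} (hs : 0 ≤ s)
    (hg : ∀ t ∈ Icc s T, 1 ≤ deriv F t) :
    (deriv (deriv F) s ≤ 0 → ∀ t ∈ Icc s T, deriv (deriv F) t ≤ 0) ∧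
    (deriv (deriv F) s < 0 → ∀ t ∈ Icc s T, deriv (deriv F) t < 0) := by
  have ix : ∀ u ∈ Ioo s T, - F u * - deriv (deriv F) u ≤
      -(-(F u * deriv (deriv F) u) - β * deriv F u * (deriv F u - 1)) := fun u hu => by
    have := hg u (Ioo_subset_Icc_self hu)
    have : 0 ≤ β * (deriv F u * (deriv F u - 1)) := mul_nonneg hβ1.le (by nlinarith)
    nlinarith
  constructor
  · intro h t ht
    have := scal (x := fun t => - deriv (deriv F) t) (p := fun t => - F t) (hF.c2 hs).neg
      (hF.c0 hs).neg (fun u hu => (hF.d2 u (by linarith [hu.1])).neg) ix (by linarith) t ht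
    linarith
  · intro h t ht
    have := scal_pos (x := fun t => - deriv (deriv F) t) (p := fun t => - F t) (hF.c2 hs).neg
      (hF.c0 hs).neg (fun u hu => (hF.d2 u (by linarith [hu.1])).neg) ix (by linarith) t ht
    linarith

lemma case_iv (hβ1 : 0 < β) (hβ2 : β ≤ 1) (ha : 0 ≤ a) (hb : 1 ≤ b) (hc : c ≤ 0)
    (hN : ¬ NA β a b c) : ∃ f : ℝ → ℝ, IsSolWithParam β a b c f ∧
        (∀ t ∈ Ici (0 : ℝ), deriv (deriv f) t ≤ 0 ∧ 1 ≤ deriv f t ∧ deriv f t ≤ b) ∧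
        Tendsto (deriv f) atTop (𝓝 1) := by
  obtain ⟨F, hF, hp⟩ := global_of_not_DD hβ1 hβ2 ha hb (fun h => hN h.na)
  have hg := hF.not_NA hN
  have hh : ∀ t ≥ 0, deriv (deriv F) t ≤ 0 := fun t ht =>
    (neg_prop hβ1 hF le_rfl (fun s hs => hg s hs.1)).1 (by rw [(hF.fs 0).h0]; exact hc) t
      ⟨ht, le_rfl⟩
  obtain ⟨l, hl, l1, -⟩ := anti_lim hF.d1 hh hg
  refine ⟨F, hF, fun t ht => ⟨hh t ht, hg t ht, ?_⟩, ?_⟩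
  · have := lin_dec (δ := 0) hF.d1 (fun t ht => by linarith [hh t ht]) t ht
    rw [(hF.fs 0).g0] at this; linarith
  · rwa [limit_one hβ1 (by linarith) hF.d0 hF.d1 hF.d2 hl] at hl

lemma case_v (hβ1 : 0 < β) (hβ2 : β ≤ 1) (ha : 0 ≤ a) (hb : 1 ≤ b) (hc : 0 < c) :
    ∃ f : ℝ → ℝ, IsSolWithParam β a b c f ∧
        ∃ t₀ > 0, (∀ t ∈ Ico 0 t₀, 0 < deriv (deriv f) t) ∧
          (∀ t ∈ Ioi t₀, deriv (deriv f) t < 0) ∧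
          Tendsto (deriv f) atTop (𝓝 1) := by
  have hN : ¬ NA β a b c := fun h => by
    have := h.lt hβ2 hb
    have := mul_nonneg ha (sub_nonneg.2 hb)
    linarith
  obtain ⟨F, hF, hp⟩ := global_of_not_DD hβ1 hβ2 ha hb (fun h => hN h.na)
  have hg := hF.not_NA hN
  have hf := hF.f_ge hp
  have ex : ∃ t ≥ 0, deriv (deriv F) t ≤ 0 := by
    by_contra! hpos
    have g1 : 1 < deriv F 1 := by
      have := smono_of (hF.c1 le_rfl) (fun s hs => hF.d1 s hs.1.le) (fun s hs => hpos s hs.1.le)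
        (show (0:ℝ) ∈ Icc 0 1 from ⟨le_rfl, zero_le_one⟩) ⟨zero_le_one, le_rfl⟩ zero_lt_one
      rw [(hF.fs 0).g0] at this; linarith
    refine no_lin_dec (g := deriv (deriv F)) (T₀ := 1) (δ := β * (deriv F 1 - 1)) (B := 0)
      (mul_pos hβ1 (by linarith)) (fun t ht => hF.d2 t (by linarith)) (fun t ht => ?_)
      (fun t ht => hpos t (by linarith))
    have t0 : 0 ≤ t := by linarith
    have h1 := mono_of (hF.c1 le_rfl) (fun s hs => hF.d1 s hs.1.le)
      (fun s hs => (hpos s hs.1.le).le)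
      (show (1:ℝ) ∈ Icc 0 t from ⟨zero_le_one, ht⟩) ⟨t0, le_rfl⟩ ht
    have h2 : 0 ≤ F t * deriv (deriv F) t := mul_nonneg (by linarith [hf t t0]) (hpos t t0).le
    have h3 : deriv F 1 - 1 ≤ deriv F t * (deriv F t - 1) := by nlinarith
    have := mul_le_mul_of_nonneg_left h3 hβ1.le
    linarith
  obtain ⟨t', ht', hle⟩ := ex
  obtain ⟨t0, ht0, e, hpos⟩ := first_zero (hF.c2 le_rfl) ht' (by rw [(hF.fs 0).h0]; exact hc) hle
  have gt : 1 < deriv F t0 := by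
    have := smono_of (hF.c1 le_rfl) (fun s hs => hF.d1 s hs.1.le)
      (fun s hs => hpos s ⟨hs.1.le, hs.2⟩)
      (show (0:ℝ) ∈ Icc 0 t0 from ⟨le_rfl, ht0.1.le⟩) ⟨ht0.1.le, le_rfl⟩ ht0.1
    rw [(hF.fs 0).g0] at this; linarith
  obtain ⟨η, hη, hη'⟩ := Metric.eventually_nhds_iff.1
    ((hF.d1 t0 ht0.1.le).continuousAt.eventually (lt_mem_nhds gt))
  have hn : ∀ t > t0, deriv (deriv F) t < 0 := by
    intro t ht
    set s := min t (t0 + η / 2)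
    have s1 : t0 < s := lt_min ht (by linarith)
    have s2 : s ≤ t := min_le_left _ _
    have s3 : s ≤ t0 + η / 2 := min_le_right _ _
    have hs := scal_strict (x := fun t => - deriv (deriv F) t) (p := fun t => - F t)
      (s := t0) (T := s) (hF.c2 ht0.1.le).neg
      (hF.c0 ht0.1.le).neg (fun u hu => (hF.d2 u (by linarith [hu.1, ht0.1])).neg) (fun u hu => by
        have := hη' (y := u) (by rw [Real.dist_eq, abs_lt]; constructor <;> linarith [hu.1, hu.2])
        have : 0 < β * (deriv F u * (deriv F u - 1)) := mul_pos hβ1 (by nlinarith)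
        nlinarith) (by linarith) s ⟨s1, le_rfl⟩
    exact (neg_prop hβ1 hF (by linarith [ht0.1]) (fun r hr => hg r (by linarith [hr.1, ht0.1]))).2
      (by linarith) t ⟨s2, le_rfl⟩
  obtain ⟨l, hl, l1, -⟩ := anti_lim (s := t0) (fun t ht => hF.d1 t (by linarith [ht0.1]))
    (fun t ht => by
      rcases ht.lt_or_eq with h | h
      · exact (hn t h).le
      · rw [← h, e]) (fun t ht => hg t (by linarith [ht0.1]))
  refine ⟨F, hF, t0, ht0.1, hpos, hn, ?_⟩
  rwa [limit_one hβ1 (by linarith) hF.d0 hF.d1 hF.d2 hl] at hl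

lemma case_iii (hβ1 : 0 < β) (hβ2 : β ≤ 1) (ha : 0 ≤ a) (hb : 1 ≤ b) (hc : c < 0)
    (hE : EE β a b c) (hN : NA β a b c) : ∃ f : ℝ → ℝ, IsSolWithParam β a b c f ∧
        ∃ t₀ > 0, (∀ t ∈ Ioo 0 t₀, deriv (deriv f) t < 0) ∧
          (∀ t ∈ Ioi t₀, 0 < deriv (deriv f) t) ∧
          Tendsto (deriv f) atTop (𝓝 1) := by
  obtain ⟨F, hF, hp⟩ := global_of_not_DD hβ1 hβ2 ha hb (hE.not_DD hβ1 hβ2 hb)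
  have hf := hF.f_ge hp
  have ex : ∃ t ≥ 0, 0 ≤ deriv (deriv F) t := by
    by_contra! hneg
    obtain ⟨l, hl, l0, hle⟩ := anti_lim hF.d1 (fun t ht => (hneg t ht).le)
      (fun t ht => (hp t ht).le)
    obtain ⟨t1, ht1, h1⟩ := hF.ofNA hN
    rcases l0.lt_or_eq with h | h
    · have := limit_one hβ1 h hF.d0 hF.d1 hF.d2 hl
      linarith [hle t1 ht1]
    · rw [← h] at hl
      obtain ⟨T, hT, hJ⟩ := hF.ofEE hE
      set ε := deriv (deriv F) T + F T * deriv F T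
      have fT : 0 ≤ F T := ha.trans (hf T hT)
      obtain ⟨t, ⟨q1, q2⟩, q3⟩ := (((hl.eventually (gt_mem_nhds hβ1)).and (hl.eventually
        (gt_mem_nhds (show 0 < ε / (F T + 1) by positivity)))).and (eventually_ge_atTop T)).exists
      rw [lt_div_iff₀ (by linarith)] at q2
      have t0 : 0 ≤ t := hT.trans q3
      have m := (hF.fs t).J_mono' hβ2 ⟨hT, q3⟩ ⟨t0, le_rfl⟩ q3
      simp only at m
      have n := hneg t t0
      have fm : F T ≤ F t := (hF.fs t).f_mono (fun s hs => (hp s hs.1).le) ⟨hT, q3⟩ ⟨t0, le_rfl⟩ q3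
      have := hp t t0
      have := mul_nonneg (sub_nonneg.2 fm) (sub_nonneg.2 q1.le)
      nlinarith
  obtain ⟨t', ht', hle⟩ := ex
  obtain ⟨t0, ht0, e, hpos⟩ := first_zero (g := fun t => - deriv (deriv F) t)
    (hF.c2 le_rfl).neg ht' (by rw [(hF.fs 0).h0]; linarith) (by linarith)
  have e0 : deriv (deriv F) t0 = 0 := by linarith
  have p0 : 0 ≤ t0 := ht0.1.le
  have glt : deriv F t0 < 1 := by
    by_contra! hge
    have ga := anti_of (hF.c1 le_rfl) (fun s hs => hF.d1 s hs.1.le)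
      (fun s hs => by linarith [hpos s ⟨hs.1.le, hs.2⟩] : ∀ s ∈ Ioo 0 t0, deriv (deriv F) s ≤ 0)
    have := (neg_prop hβ1 hF le_rfl (fun s hs => hge.trans (ga hs ⟨p0, le_rfl⟩ hs.2))).2
      (by rw [(hF.fs 0).h0]; exact hc) t0 ⟨p0, le_rfl⟩
    linarith
  have glt' : ∀ t ≥ t0, deriv F t < 1 := by
    intro t ht
    have cz : ContinuousOn (fun t => -(deriv (deriv F) t + F t * (deriv F t - 1))) (Icc t0 t) :=
      ((hF.c2 p0).add ((hF.c0 p0).mul ((hF.c1 p0).sub continuousOn_const))).neg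
    have cx : ContinuousOn (fun t => 1 - deriv F t) (Icc t0 t) := continuousOn_const.sub (hF.c1 p0)
    have dx : ∀ u ∈ Ioo t0 t, HasDerivAt (fun t => 1 - deriv F t) (- deriv (deriv F) u) u :=
      fun u hu => (hF.d1 u (by linarith [hu.1])).const_sub 1
    have cc := coop (x := fun t => 1 - deriv F t)
      (z := fun t => -(deriv (deriv F) t + F t * (deriv F t - 1)))
      (p := fun t => - F t) (r := fun t => (1 - β) * deriv F t) (s := t0) (T := t) cx cz
      (hF.c0 p0).neg (continuousOn_const.mul (hF.c1 p0)) dx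
      (fun u hu => ((hF.fs u).dH u ⟨by linarith [hu.1], le_rfl⟩).neg)
      (fun u hu => by linarith) (fun u hu => by linarith)
      (fun u hu => mul_nonneg (by linarith) (hp u (by linarith [hu.1])).le) (by linarith)
      (by
        have := mul_nonneg (ha.trans (hf t0 p0)) (by linarith : 0 ≤ 1 - deriv F t0)
        rw [e0]; linarith)
    have := scal_pos (x := fun t => 1 - deriv F t) (p := fun t => - F t) cx (hF.c0 p0).neg dx
      (fun u hu => by have := (cc u (Ioo_subset_Icc_self hu)).2; linarith) (by linarith) t
      ⟨ht, le_rfl⟩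
    linarith
  have hpos' : ∀ t > t0, 0 < deriv (deriv F) t := by
    intro t ht
    exact scal_strict (p := fun t => - F t) (hF.c2 p0) (hF.c0 p0).neg
      (fun u hu => hF.d2 u (by linarith [hu.1])) (fun u hu => by
        have h1 := glt' u hu.1.le
        have h2 := hp u (by linarith [hu.1])
        have : 0 < β * (deriv F u * (1 - deriv F u)) := mul_pos hβ1 (mul_pos h2 (by linarith))
        linarith) e0.ge t ⟨ht, le_rfl⟩
  obtain ⟨l, hl, l1, l2⟩ := anti_lim (g := fun t => - deriv F t) (s := t0) (B := -1)
    (fun t ht => (hF.d1 t (by linarith)).neg)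
    (fun t ht => by
      rcases ht.lt_or_eq with h | h
      · linarith [hpos' t h]
      · rw [← h, e0]; simp) (fun t ht => by linarith [glt' t ht])
  have hl' : Tendsto (deriv F) atTop (𝓝 (-l)) := by simpa using hl.neg
  have h3 := l2 t0 le_rfl
  have h4 := hp t0 p0
  refine ⟨F, hF, t0, ht0.1, fun t ht => by linarith [hpos t ⟨ht.1.le, ht.2⟩], hpos', ?_⟩
  rwa [limit_one hβ1 (by linarith) hF.d0 hF.d1 hF.d2 hl'] at hl'

end final

/-- full shooting description for `β ∈ (0,1]`, `a ≥ 0`, `b ≥ 1`. -/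
theorem stmt15 (β a b : ℝ) (hβ1 : 0 < β) (hβ2 : β ≤ 1) (ha : 0 ≤ a) (hb : 1 ≤ b) :
    ∃ cs cstar : ℝ, cs < 0 ∧ cs < cstar ∧ cstar ≤ -(a * (b - 1)) ∧
      (∀ c < cs, ¬ ∃ f : ℝ → ℝ, IsSolWithParam β a b c f) ∧
      (∃ f : ℝ → ℝ, IsSolWithParam β a b cs f ∧
        (∀ t ∈ Ici (0 : ℝ), deriv (deriv f) t < 0) ∧
        Tendsto (deriv f) atTop (𝓝 0)) ∧
      (∀ c : ℝ, cs < c → c < cstar → ∃ f : ℝ → ℝ, IsSolWithParam β a b c f ∧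
        ∃ t₀ > 0, (∀ t ∈ Ioo 0 t₀, deriv (deriv f) t < 0) ∧
          (∀ t ∈ Ioi t₀, 0 < deriv (deriv f) t) ∧
          Tendsto (deriv f) atTop (𝓝 1)) ∧
      (∀ c : ℝ, cstar ≤ c → c ≤ 0 → ∃ f : ℝ → ℝ, IsSolWithParam β a b c f ∧
        (∀ t ∈ Ici (0 : ℝ), deriv (deriv f) t ≤ 0 ∧ 1 ≤ deriv f t ∧ deriv f t ≤ b) ∧
        Tendsto (deriv f) atTop (𝓝 1)) ∧
      (∀ c : ℝ, 0 < c → ∃ f : ℝ → ℝ, IsSolWithParam β a b c f ∧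
        ∃ t₀ > 0, (∀ t ∈ Ico 0 t₀, 0 < deriv (deriv f) t) ∧
          (∀ t ∈ Ioi t₀, deriv (deriv f) t < 0) ∧
          Tendsto (deriv f) atTop (𝓝 1)) := by
  have ab := mul_nonneg ha (sub_nonneg.2 hb)
  have NAneg : ∀ c, NA β a b c → c < 0 := fun c h => by
    have := h.lt hβ2 hb
    linarith
  have E0 : EE β a b 0 := not_NA.EE hβ1 hβ2 ha hb fun h => lt_irrefl _ (NAneg _ h)
  have D0 := DD_exists hβ1 hβ2 ha hb
  set A : Set ℝ := {c | c ≤ 0 ∧ ¬ EE β a b c} with hA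
  have DA : ∀ c, DD β a b c → c ∈ A := fun c h =>
    ⟨(NAneg c h.na).le, fun hE => hE.not_DD hβ1 hβ2 hb h⟩
  have Ane : A.Nonempty := ⟨_, DA _ D0⟩
  have Abd : BddAbove A := ⟨0, fun c h => h.1⟩
  set cs := sSup A with hcs
  have cs0 : cs ≤ 0 := csSup_le Ane fun c h => h.1
  have csE : ¬ EE β a b cs := by
    intro h
    obtain ⟨δ, hδ, hd⟩ := EE_open h
    obtain ⟨c, hc, hlt⟩ := exists_lt_of_lt_csSup Ane (show cs - δ < sSup A by linarith)
    have := le_csSup Abd hc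
    exact hc.2 (hd c (by rw [abs_lt]; constructor <;> linarith))
  have csneg : cs < 0 := by
    rcases cs0.lt_or_eq with h | h
    · exact h
    · rw [h] at csE; exact absurd E0 csE
  have csD : ¬ DD β a b cs := by
    intro h
    obtain ⟨δ, hδ, hd⟩ := DD_open h
    have := le_csSup Abd (DA _ (hd (cs + δ / 2) (by rw [abs_lt]; constructor <;> linarith)))
    linarith
  have below : ∀ c ≤ cs, NA β a b c := by
    intro c hc
    rcases hc.lt_or_eq with h | h
    · exact (DD_below hβ1 hβ2 ha hb h csneg csE).na
    · rw [h]
      by_contra hN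
      exact csE (not_NA.EE hβ1 hβ2 ha hb hN)
  have above : ∀ c, cs < c → EE β a b c := by
    intro c hc
    by_contra hE
    by_cases h0 : c ≤ 0
    · linarith [le_csSup Abd (show c ∈ A from ⟨h0, hE⟩)]
    · exact hE (not_NA.EE hβ1 hβ2 ha hb fun h => h0 (NAneg _ h).le)
  set B : Set ℝ := {c | ¬ NA β a b c} with hB
  have Bm : -(a * (b - 1)) ∈ B := fun h => lt_irrefl _ (h.lt hβ2 hb)
  have Bbd : BddBelow B := ⟨cs, fun c h => by
    by_contra! hlt
    exact h (below c hlt.le)⟩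
  set cstar := sInf B with hcst
  have cstN : ¬ NA β a b cstar := by
    intro h
    obtain ⟨δ, hδ, hd⟩ := NA_open h
    obtain ⟨c, hc, hlt⟩ := exists_lt_of_csInf_lt ⟨_, Bm⟩ (show sInf B < cstar + δ by linarith)
    have := csInf_le Bbd hc
    exact hc (hd c (by rw [abs_lt]; constructor <;> linarith))
  have hlt : cs < cstar := by
    by_contra! hle
    exact cstN (below _ hle)
  refine ⟨cs, cstar, csneg, hlt, csInf_le Bbd Bm, ?_, ?_, ?_, ?_, ?_⟩
  · exact fun c hc => (DD_below hβ1 hβ2 ha hb hc csneg csE).no_sol hβ1 hb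
  · obtain ⟨F, hF, hp⟩ := global_of_not_DD hβ1 hβ2 ha hb csD
    obtain ⟨h1, h2⟩ := not_EE_neg ha hb csneg hF hp csE
    exact ⟨F, hF, h1, h2⟩
  · intro c h1 h2
    have hN : NA β a b c := by
      by_contra hN
      linarith [csInf_le Bbd (show c ∈ B from hN)]
    exact case_iii hβ1 hβ2 ha hb (NAneg c hN) (above c h1) hN
  · intro c h1 h2
    refine case_iv hβ1 hβ2 ha hb h2 fun hN => ?_
    rcases h1.lt_or_eq with h | h
    · exact cstN (NA_below hβ1 hβ2 ha hb h hN)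
    · rw [h] at cstN; exact cstN hN
  · exact fun c hc => case_v hβ1 hβ2 ha hb hc
end
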